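/- Let d ∈ ℕ, 1 < p ≤ 2, 0 < η ≤ p and r > 1/p + 1/η − 1. Then σ_m(S^r_p W)_{A_η} ≍ m^{−(r + 1 − 1/p − 1/η)} · (log* m)^{(d−1)(r + 1 − 2/p)}. -/

import Mathlib

open MeasureTheory Real ENNReal

noncomputable section

namespace Paper

/-- The fundamental domain `[0,1)^d` of the `d`-dimensional torus `𝕋^d`. -/
def cube (d : ℕ) : Set (Fin d → ℝ) := Set.univ.pi fun _ => Set.Ico (0:ℝ) 1

/-- The trigonometric character `x ↦ e^{2π i k·x}`. -/
def expk (d : ℕ) (k : Fin d → ℤ) (x : Fin d → ℝ) : ℂ :=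
  Complex.exp (((2 * Real.pi * ∑ i, (k i : ℝ) * x i : ℝ) : ℂ) * Complex.I)

/-- Fourier coefficient `f̂(k) = ∫_{[0,1)^d} f(x) e^{-2π i k·x} dx`. -/
def fCoeff (d : ℕ) (f : (Fin d → ℝ) → ℂ) (k : Fin d → ℤ) : ℂ :=
  ∫ x in cube d, f x * expk d (-k) x

/-- The `L_q` (quasi-)norm on the torus, `q ∈ (0,∞]`, valued in `ℝ≥0∞`
(for `q = ∞` this is the essential supremum). -/
def LqNorm (d : ℕ) (q : ℝ≥0∞) (f : (Fin d → ℝ) → ℂ) : ℝ≥0∞ :=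
  eLpNorm f q (volume.restrict (cube d))

/-- The weight `∏_{i=1}^d (1+|k_i|)`. -/
def wt (d : ℕ) (k : Fin d → ℤ) : ℝ := ∏ i, (1 + |(k i : ℝ)|)

/-- The weighted Wiener (quasi-)norm `‖f‖_{S^r_θ A}`
(with the sup modification for `θ = ∞`); `A_θ` corresponds to `r = 0`,
the Wiener algebra `A` to `r = 0`, `θ = 1`. -/
def wienerNorm (d : ℕ) (r : ℝ) (θ : ℝ≥0∞) (f : (Fin d → ℝ) → ℂ) : ℝ≥0∞ :=
  if θ = ∞ then ⨆ k : Fin d → ℤ, ENNReal.ofReal (wt d k ^ r) * (‖fCoeff d f k‖₊ : ℝ≥0∞)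
  else (∑' k : Fin d → ℤ,
      (ENNReal.ofReal (wt d k ^ r) * (‖fCoeff d f k‖₊ : ℝ≥0∞)) ^ θ.toReal) ^ (1 / θ.toReal)

/-- Trigonometric polynomials with at most `m` terms. -/
def trigPoly (d m : ℕ) : Set ((Fin d → ℝ) → ℂ) :=
  {s | ∃ (Λ : Finset (Fin d → ℤ)) (a : (Fin d → ℤ) → ℂ),
    Λ.card ≤ m ∧ s = fun x => ∑ k ∈ Λ, a k * expk d k x}

/-- Best `m`-term trigonometric approximation error of `f`, error measured by `X`. -/
def sigmaF (d m : ℕ) (X : ((Fin d → ℝ) → ℂ) → ℝ≥0∞) (f : (Fin d → ℝ) → ℂ) : ℝ≥0∞ :=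
  ⨅ s ∈ trigPoly d m, X (f - s)

/-- The unit ball of the space (inside `L₁(𝕋^d)`) with (quasi-)norm `N`. -/
def unitBall (d : ℕ) (N : ((Fin d → ℝ) → ℂ) → ℝ≥0∞) : Set ((Fin d → ℝ) → ℂ) :=
  {f | IntegrableOn f (cube d) ∧ N f ≤ 1}

/-- Best `m`-term trigonometric width of the unit ball of `N`, error measured by `X`. -/
def sigmaClass (d m : ℕ) (N X : ((Fin d → ℝ) → ℂ) → ℝ≥0∞) : ℝ≥0∞ :=
  ⨆ f ∈ unitBall d N, sigmaF d m X f

/-- `log*(m) = max (log₂ m) 1`. -/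
def logStar (m : ℕ) : ℝ := max (Real.logb 2 m) 1

/-- Two-sided asymptotic equivalence `a_m ≍ b_m`. -/
def IsAsympEquiv (a : ℕ → ℝ≥0∞) (b : ℕ → ℝ) : Prop :=
  ∃ c C : ℝ, 0 < c ∧ 0 < C ∧ ∃ m₀ : ℕ, ∀ m : ℕ, m₀ ≤ m →
    ENNReal.ofReal (c * b m) ≤ a m ∧ a m ≤ ENNReal.ofReal (C * b m)

/-- One-sided asymptotic bound `a_m ≲ b_m`. -/
def IsAsympLe (a : ℕ → ℝ≥0∞) (b : ℕ → ℝ) : Prop :=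
  ∃ C : ℝ, 0 < C ∧ ∃ m₀ : ℕ, ∀ m : ℕ, m₀ ≤ m → a m ≤ ENNReal.ofReal (C * b m)

/-- Dyadic block `I_0 = {0}`, `I_n = {k : 2^{n-1} ≤ |k| < 2^n}` for `n ≥ 1`. -/
def blockF (n : ℕ) : Finset ℤ :=
  (Finset.Icc (-(2^n : ℤ)) (2^n)).filter fun k =>
    (n = 0 ∧ k = 0) ∨ (n ≠ 0 ∧ 2^(n-1) ≤ |k| ∧ |k| < 2^n)

/-- The dyadic block projection `∑_{k ∈ I_j} f̂(k) e^{2π i k·x}`. -/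
def blockProj (d : ℕ) (f : (Fin d → ℝ) → ℂ) (j : Fin d → ℕ) : (Fin d → ℝ) → ℂ :=
  fun x => ∑ k ∈ Fintype.piFinset (fun i => blockF (j i)), fCoeff d f k * expk d k x

/-- The mixed-smoothness Besov (quasi-)norm `‖f‖_{S^s_{p,θ}B}`
(with the sup modification for `θ = ∞`). -/
def besovNorm (d : ℕ) (s : ℝ) (p θ : ℝ≥0∞) (f : (Fin d → ℝ) → ℂ) : ℝ≥0∞ :=
  if θ = ∞ then
    ⨆ j : Fin d → ℕ,
      ENNReal.ofReal ((2:ℝ) ^ (((∑ i, j i : ℕ) : ℝ) * s)) * LqNorm d p (blockProj d f j)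
  else
    (∑' j : Fin d → ℕ,
      (ENNReal.ofReal ((2:ℝ) ^ (((∑ i, j i : ℕ) : ℝ) * s)) * LqNorm d p (blockProj d f j))
        ^ θ.toReal) ^ (1 / θ.toReal)

/-- The mixed-smoothness Sobolev norm `‖f‖_{S^s_p W}` (Littlewood–Paley form),
with `S^0_p W := L_p`. -/
def sobolevNorm (d : ℕ) (s : ℝ) (p : ℝ≥0∞) (f : (Fin d → ℝ) → ℂ) : ℝ≥0∞ :=
  if s = 0 then LqNorm d p f
  else
    (∫⁻ x in cube d,
      ((∑' j : Fin d → ℕ,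
        (ENNReal.ofReal ((2:ℝ) ^ (((∑ i, j i : ℕ) : ℝ) * s)) *
          (‖blockProj d f j x‖₊ : ℝ≥0∞)) ^ (2:ℕ)) ^ ((1:ℝ)/2)) ^ p.toReal) ^ (1 / p.toReal)

/-- Trigonometric polynomials with frequencies in `[-M,M]^d`. -/
def boxPoly (d M : ℕ) : Set ((Fin d → ℝ) → ℂ) :=
  {s | ∃ (Λ : Finset (Fin d → ℤ)) (a : (Fin d → ℤ) → ℂ),
    (∀ k ∈ Λ, ∀ i, |k i| ≤ (M : ℤ)) ∧ s = fun x => ∑ k ∈ Λ, a k * expk d k x}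

/-- Error of best approximation by trigonometric polynomials with
frequencies in `[-M,M]^d`, measured in `L_∞`. -/
def EBox (d M : ℕ) (f : (Fin d → ℝ) → ℂ) : ℝ≥0∞ :=
  ⨅ g ∈ boxPoly d M, LqNorm d ∞ (f - g)

/-- The `m`-th (non-linear) sampling width of the class of continuous functions
in the unit ball of `N`, error measured in `L_q`. -/
def samplingWidth (d m : ℕ) (N : ((Fin d → ℝ) → ℂ) → ℝ≥0∞) (q : ℝ≥0∞) : ℝ≥0∞ :=
  ⨅ (t : Fin m → (Fin d → ℝ)) (_ : ∀ i, t i ∈ cube d)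
    (R : (Fin m → ℂ) → ((Fin d → ℝ) → ℂ)),
    ⨆ f ∈ {f : (Fin d → ℝ) → ℂ | Continuous f ∧ N f ≤ 1},
      LqNorm d q (f - R fun i => f (t i))


theorem lintegral_Ioi_indicator_lt_rpow {s : ℝ} (hs : -1 < s) {y : ℝ} (hy : 0 ≤ y) :
    ∫⁻ t in Set.Ioi (0 : ℝ), (if t < y then ENNReal.ofReal (t ^ s) else 0)
      = ENNReal.ofReal (y ^ (s + 1) / (s + 1)) := by
  have h1 : ∫⁻ t in Set.Ioi (0 : ℝ), (if t < y then ENNReal.ofReal (t ^ s) else 0)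
      = ∫⁻ t in Set.Ioo (0 : ℝ) y, ENNReal.ofReal (t ^ s) := by
    rw [← Set.Ioi_inter_Iio, Set.inter_comm, ← Measure.restrict_restrict measurableSet_Iio,
      ← lintegral_indicator measurableSet_Iio]
    rfl
  have hint : IntervalIntegrable (fun t : ℝ => t ^ s) volume 0 y :=
    intervalIntegral.intervalIntegrable_rpow' hs
  rw [h1, Measure.restrict_congr_set Ioo_ae_eq_Ioc,
    ← ofReal_integral_eq_lintegral_ofReal, ← intervalIntegral.integral_of_le hy,
    integral_rpow (Or.inl hs), Real.zero_rpow (by linarith), sub_zero]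
  · exact (intervalIntegrable_iff_integrableOn_Ioc_of_le hy).1 hint
  · filter_upwards [ae_restrict_mem measurableSet_Ioc] with t ht
    exact Real.rpow_nonneg ht.1.le _

theorem lintegral_Ioi_indicator_le_rpow {s : ℝ} (hs : s < -1) {y : ℝ} (hy : 0 < y) :
    ∫⁻ t in Set.Ioi (0 : ℝ), (if y ≤ t then ENNReal.ofReal (t ^ s) else 0)
      = ENNReal.ofReal (-y ^ (s + 1) / (s + 1)) := by
  have h1 : ∫⁻ t in Set.Ioi (0 : ℝ), (if y ≤ t then ENNReal.ofReal (t ^ s) else 0)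
      = ∫⁻ t in Set.Ici y, ENNReal.ofReal (t ^ s) := by
    have : Set.Ici y = Set.Ici y ∩ Set.Ioi 0 := by
      ext t; simp only [Set.mem_Ici, Set.mem_inter_iff, Set.mem_Ioi]; grind
    rw [this, ← Measure.restrict_restrict measurableSet_Ici,
      ← lintegral_indicator measurableSet_Ici]
    rfl
  rw [h1, Measure.restrict_congr_set Ioi_ae_eq_Ici.symm,
    ← ofReal_integral_eq_lintegral_ofReal, integral_Ioi_rpow_of_lt hs hy]
  · exact integrableOn_Ioi_rpow_of_lt hs hy
  · filter_upwards [ae_restrict_mem measurableSet_Ioi] with t ht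
    exact Real.rpow_nonneg (hy.trans ht).le _

/-- A finite orthonormal system of functions bounded by one. -/
structure IsBddOrthonormal {Ω ι : Type*} [MeasurableSpace Ω] [DecidableEq ι] (μ : Measure Ω)
    (φ : ι → Ω → ℂ) : Prop where
  meas : ∀ i, Measurable (φ i)
  norm_le : ∀ i x, ‖φ i x‖ ≤ 1
  orth : ∀ i j, ∫ x, starRingEnd ℂ (φ i x) * φ j x ∂μ = if i = j then 1 else 0

set_option linter.unusedSectionVars false

section Bessel

variable {Ω ι H : Type*} [MeasurableSpace Ω] [Fintype ι] [DecidableEq ι] {μ : Measure Ω}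
  [IsProbabilityMeasure μ] [NormedAddCommGroup H] [InnerProductSpace ℂ H] [CompleteSpace H]
  {φ : ι → Ω → ℂ}

theorem IsBddOrthonormal.stronglyMeasurable_sum (hφ : IsBddOrthonormal μ φ) (v : ι → H) :
    StronglyMeasurable (fun x => ∑ i, φ i x • v i) :=
  Finset.stronglyMeasurable_fun_sum _ fun i _ => (hφ.meas i).stronglyMeasurable.smul_const (v i)

theorem IsBddOrthonormal.norm_sum_le (hφ : IsBddOrthonormal μ φ) (v : ι → H) (x : Ω) :
    ‖∑ i, φ i x • v i‖ ≤ ∑ i, ‖v i‖ := by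
  refine (_root_.norm_sum_le _ _).trans (Finset.sum_le_sum fun i _ => ?_)
  rw [norm_smul]
  exact mul_le_of_le_one_left (norm_nonneg _) (hφ.norm_le i x)

theorem integrable_of_norm_le {E : Type*} [NormedAddCommGroup E] {g : Ω → E}
    (hg : AEStronglyMeasurable g μ) {B : ℝ} (hB : ∀ x, ‖g x‖ ≤ B) : Integrable g μ :=
  Integrable.of_bound hg B (Filter.Eventually.of_forall hB)

theorem IsBddOrthonormal.integrable_conj_smul (hφ : IsBddOrthonormal μ φ) {g : Ω → H}
    (hg : AEStronglyMeasurable g μ) {B : ℝ} (hB : ∀ x, ‖g x‖ ≤ B) (i : ι) :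
    Integrable (fun x => starRingEnd ℂ (φ i x) • g x) μ := by
  refine integrable_of_norm_le (B := B) ?_ fun x => ?_
  · exact ((Complex.continuous_conj.measurable.comp (hφ.meas i)).aestronglyMeasurable).smul hg
  · rw [norm_smul, RCLike.norm_conj]
    exact (mul_le_of_le_one_left (norm_nonneg _) (hφ.norm_le i x)).trans (hB x)

theorem IsBddOrthonormal.integrable_conj_mul (hφ : IsBddOrthonormal μ φ) (i j : ι) :
    Integrable (fun x => starRingEnd ℂ (φ i x) * φ j x) μ :=
  hφ.integrable_conj_smul (hφ.meas j).aestronglyMeasurable (hφ.norm_le j) i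

theorem IsBddOrthonormal.integral_norm_sq (hφ : IsBddOrthonormal μ φ) (v : ι → H) :
    ∫ x, ‖∑ i, φ i x • v i‖ ^ 2 ∂μ = ∑ i, ‖v i‖ ^ 2 := by
  have h : ∫ x, ((‖∑ i, φ i x • v i‖ ^ 2 : ℝ) : ℂ) ∂μ = ((∑ i, ‖v i‖ ^ 2 : ℝ) : ℂ) := by
    have : ∀ x, ((‖∑ i, φ i x • v i‖ ^ 2 : ℝ) : ℂ)
        = ∑ i, ∑ j, (starRingEnd ℂ (φ i x) * φ j x) * inner ℂ (v i) (v j) := by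
      intro x
      rw [Complex.ofReal_pow, ← Complex.coe_algebraMap, ← inner_self_eq_norm_sq_to_K (𝕜 := ℂ),
        sum_inner]
      refine Finset.sum_congr rfl fun i _ => ?_
      rw [inner_sum]
      refine Finset.sum_congr rfl fun j _ => ?_
      rw [inner_smul_left, inner_smul_right]
      ring
    simp_rw [this]
    rw [integral_finsetSum _ fun i _ => integrable_finsetSum _ fun j _ =>
      (hφ.integrable_conj_mul i j).mul_const _]
    push_cast
    refine Finset.sum_congr rfl fun i _ => ?_
    rw [integral_finsetSum _ fun j _ => (hφ.integrable_conj_mul i j).mul_const _]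
    simp_rw [integral_mul_const, hφ.orth]
    simp [inner_self_eq_norm_sq_to_K]
  rw [integral_complex_ofReal] at h
  exact_mod_cast h

theorem IsBddOrthonormal.integral_conj_smul_sum (hφ : IsBddOrthonormal μ φ) (v : ι → H) (i : ι) :
    ∫ x, starRingEnd ℂ (φ i x) • ∑ j, φ j x • v j ∂μ = v i := by
  simp_rw [Finset.smul_sum, smul_smul]
  rw [integral_finsetSum _ fun j _ => (hφ.integrable_conj_mul i j).smul_const _]
  simp_rw [integral_smul_const, hφ.orth]
  simp

/-- Bessel's inequality for Hilbert-space-valued functions. -/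
theorem IsBddOrthonormal.sum_norm_sq_le (hφ : IsBddOrthonormal μ φ) {g : Ω → H}
    (hg : AEStronglyMeasurable g μ) {B : ℝ} (hB : ∀ x, ‖g x‖ ≤ B) :
    ∑ i, ‖∫ x, starRingEnd ℂ (φ i x) • g x ∂μ‖ ^ 2 ≤ ∫ x, ‖g x‖ ^ 2 ∂μ := by
  set b : ι → H := fun i => ∫ x, starRingEnd ℂ (φ i x) • g x ∂μ with hb
  set h : Ω → H := fun x => ∑ i, φ i x • b i with hh
  have hhm : AEStronglyMeasurable h μ := (hφ.stronglyMeasurable_sum b).aestronglyMeasurable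
  have hhB := hφ.norm_sum_le (H := H) b
  have hsq : ∀ {u : Ω → H} {C : ℝ}, AEStronglyMeasurable u μ → (∀ x, ‖u x‖ ≤ C) →
      Integrable (fun x => ‖u x‖ ^ 2) μ := fun {u C} hu hC => by
    refine integrable_of_norm_le (B := C ^ 2) (hu.norm.pow 2) fun x => ?_
    rw [norm_pow, norm_norm]
    exact pow_le_pow_left₀ (norm_nonneg _) (hC x) 2
  have key : ∫ x, (inner ℂ (h x) (g x) : ℂ) ∂μ = ((∑ i, ‖b i‖ ^ 2 : ℝ) : ℂ) := by
    have : ∀ x, (inner ℂ (h x) (g x) : ℂ) = ∑ i, inner ℂ (b i) (starRingEnd ℂ (φ i x) • g x) := by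
      intro x
      rw [hh, sum_inner]
      exact Finset.sum_congr rfl fun i _ => by rw [inner_smul_left, inner_smul_right]
    simp_rw [this]
    rw [integral_finsetSum _ fun i _ => (hφ.integrable_conj_smul hg hB i).const_inner _]
    push_cast
    refine Finset.sum_congr rfl fun i _ => ?_
    rw [integral_inner (hφ.integrable_conj_smul hg hB i), inner_self_eq_norm_sq_to_K]
    rfl
  have hgh : Integrable (fun x => (inner ℂ (h x) (g x) : ℂ)) μ := by
    refine integrable_of_norm_le (B := (∑ i, ‖b i‖) * B) (hhm.inner hg) fun x => ?_
    exact (norm_inner_le_norm _ _).trans (mul_le_mul (hhB x) (hB x) (norm_nonneg _)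
      (Finset.sum_nonneg fun i _ => norm_nonneg _))
  have hre : ∫ x, (inner ℂ (h x) (g x) : ℂ).re ∂μ = ∑ i, ‖b i‖ ^ 2 := by
    have := integral_re hgh
    rw [key] at this
    exact this.trans (RCLike.ofReal_re (K := ℂ) _)
  have hle : ∫ x, (inner ℂ (h x) (g x) : ℂ).re ∂μ
      ≤ ∫ x, ((1 / 2) * ‖h x‖ ^ 2 + (1 / 2) * ‖g x‖ ^ 2) ∂μ := by
    refine integral_mono hgh.re (((hsq hhm hhB).const_mul _).add ((hsq hg hB).const_mul _))
      fun x => ?_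
    have h1 : (inner ℂ (h x) (g x) : ℂ).re ≤ ‖h x‖ * ‖g x‖ :=
      (Complex.re_le_norm _).trans (norm_inner_le_norm _ _)
    change (inner ℂ (h x) (g x) : ℂ).re ≤ _
    nlinarith [sq_nonneg (‖h x‖ - ‖g x‖)]
  rw [integral_add ((hsq hhm hhB).const_mul _) ((hsq hg hB).const_mul _), integral_const_mul,
    integral_const_mul, hφ.integral_norm_sq b, hre] at hle
  linarith

/-- The weak-type estimate behind Paley's inequality, obtained by cutting at height `t`. -/
theorem IsBddOrthonormal.sum_weight_le (hφ : IsBddOrthonormal μ φ) {ω : ι → ℝ}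
    (hω : ∀ i, 0 < ω i) {K : ℝ}
    (hωK : ∀ t > 0, ∑ i with t < ω i, (ω i ^ 2)⁻¹ ≤ K / t) (v : ι → H) {t : ℝ} (ht : 0 < t) :
    ∑ i with t < ω i * ‖v i‖ / 2, (ω i ^ 2)⁻¹
      ≤ K * t⁻¹ * ∫ x, (if t < ‖∑ i, φ i x • v i‖ then ‖∑ i, φ i x • v i‖ else 0) ∂μ
        + (t ^ 2)⁻¹ *
          ∫ x, (if ‖∑ i, φ i x • v i‖ ≤ t then ‖∑ i, φ i x • v i‖ ^ 2 else 0) ∂μ := by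
  classical
  set g : Ω → H := fun x => ∑ i, φ i x • v i with hg
  have hgm : StronglyMeasurable g := hφ.stronglyMeasurable_sum v
  have hgB : ∀ x, ‖g x‖ ≤ ∑ i, ‖v i‖ := hφ.norm_sum_le v
  set B := ∑ i, ‖v i‖
  have hB0 : 0 ≤ B := Finset.sum_nonneg fun i _ => norm_nonneg _
  set g₁ : Ω → H := fun x => if t < ‖g x‖ then g x else 0 with hg1
  set g₂ : Ω → H := fun x => if ‖g x‖ ≤ t then g x else 0 with hg2
  have hm1 : AEStronglyMeasurable g₁ μ := (StronglyMeasurable.ite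
    (measurableSet_lt measurable_const hgm.norm.measurable) hgm
    stronglyMeasurable_const).aestronglyMeasurable
  have hm2 : AEStronglyMeasurable g₂ μ := (StronglyMeasurable.ite
    (measurableSet_le hgm.norm.measurable measurable_const) hgm
    stronglyMeasurable_const).aestronglyMeasurable
  have hB1 : ∀ x, ‖g₁ x‖ ≤ B := fun x => by
    simp only [hg1]; split_ifs
    · exact hgB x
    · simpa using hB0
  have hB2 : ∀ x, ‖g₂ x‖ ≤ B := fun x => by
    simp only [hg2]; split_ifs
    · exact hgB x
    · simpa using hB0
  have hsum : ∀ x, g x = g₁ x + g₂ x := fun x => by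
    simp only [hg1, hg2]
    by_cases h : t < ‖g x‖
    · simp [h, h.not_ge]
    · simp [h, not_lt.1 h]
  set a : ι → H := fun i => ∫ x, starRingEnd ℂ (φ i x) • g₁ x ∂μ with ha
  set b : ι → H := fun i => ∫ x, starRingEnd ℂ (φ i x) • g₂ x ∂μ with hb
  have hv : ∀ i, v i = a i + b i := fun i => by
    rw [ha, hb, ← integral_add (hφ.integrable_conj_smul hm1 hB1 i)
      (hφ.integrable_conj_smul hm2 hB2 i), ← hφ.integral_conj_smul_sum v i]
    congr 1; ext x
    rw [← smul_add, ← hsum]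
  have e1 : ∀ x, (if t < ‖g x‖ then ‖g x‖ else 0) = ‖g₁ x‖ := fun x => by
    simp only [hg1]; split_ifs <;> simp
  have e2 : ∀ x, (if ‖g x‖ ≤ t then ‖g x‖ ^ 2 else 0) = ‖g₂ x‖ ^ 2 := fun x => by
    simp only [hg2]; split_ifs <;> simp
  change _ ≤ K * t⁻¹ * ∫ x, (if t < ‖g x‖ then ‖g x‖ else 0) ∂μ
    + (t ^ 2)⁻¹ * ∫ x, (if ‖g x‖ ≤ t then ‖g x‖ ^ 2 else 0) ∂μ
  simp_rw [e1, e2]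
  set A := ∫ x, ‖g₁ x‖ ∂μ
  have hA0 : 0 ≤ A := integral_nonneg fun x => norm_nonneg _
  have haA : ∀ i, ‖a i‖ ≤ A := fun i => by
    refine norm_integral_le_of_norm_le (integrable_of_norm_le hm1 hB1).norm
      (Filter.Eventually.of_forall fun x => ?_)
    rw [norm_smul, RCLike.norm_conj]
    exact mul_le_of_le_one_left (norm_nonneg _) (hφ.norm_le i x)
  have hbB : ∑ i, ‖b i‖ ^ 2 ≤ ∫ x, ‖g₂ x‖ ^ 2 ∂μ := hφ.sum_norm_sq_le hm2 hB2
  have hsplit : ∑ i with t < ω i * ‖v i‖ / 2, (ω i ^ 2)⁻¹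
      ≤ ∑ i with t < ω i * A, (ω i ^ 2)⁻¹ + ∑ i, (t ^ 2)⁻¹ * ‖b i‖ ^ 2 := by
    rw [Finset.sum_filter, Finset.sum_filter, ← Finset.sum_add_distrib]
    refine Finset.sum_le_sum fun i _ => ?_
    have hwi := hω i
    have hpos : 0 < (ω i ^ 2)⁻¹ := by positivity
    have hbi : 0 ≤ (t ^ 2)⁻¹ * ‖b i‖ ^ 2 := by positivity
    by_cases h1 : t < ω i * ‖v i‖ / 2
    · rw [if_pos h1]
      by_cases h2 : t < ω i * A
      · rw [if_pos h2]; linarith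
      · rw [if_neg h2, zero_add]
        have h3 : ‖v i‖ ≤ A + ‖b i‖ := by
          rw [hv i]; exact (norm_add_le _ _).trans (by gcongr; exact haA i)
        have h4 : t ≤ ω i * ‖b i‖ := by nlinarith
        rw [inv_le_iff_one_le_mul₀ (by positivity)]
        rw [show (t ^ 2)⁻¹ * ‖b i‖ ^ 2 * ω i ^ 2 = (ω i * ‖b i‖ / t) ^ 2 by field_simp]
        exact one_le_pow₀ ((one_le_div ht).2 h4)
    · rw [if_neg h1]
      split_ifs <;> linarith
  refine hsplit.trans (add_le_add ?_ ?_)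
  · rcases hA0.eq_or_lt with h0 | h0
    · rw [← h0]
      simp [ht.le.not_gt]
    · have := hωK (t / A) (by positivity)
      calc _ = ∑ i with t / A < ω i, (ω i ^ 2)⁻¹ := by
            refine Finset.sum_congr (Finset.filter_congr fun i _ => ?_) fun _ _ => rfl
            rw [div_lt_iff₀ h0]
        _ ≤ K / (t / A) := this
        _ = _ := by field_simp
  · rw [← Finset.mul_sum]
    gcongr

end Bessel

section Paley

variable {Ω ι H : Type*} [MeasurableSpace Ω] [Fintype ι] [DecidableEq ι] {μ : Measure Ω}
  [IsProbabilityMeasure μ] [NormedAddCommGroup H] [InnerProductSpace ℂ H] [CompleteSpace H]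
  {φ : ι → Ω → ℂ}

theorem lintegral_truncate_above {N : Ω → ℝ} (hN : Measurable N) (hN0 : ∀ x, 0 ≤ N x) {P : ℝ}
    (hP : 1 < P) :
    ∫⁻ t in Set.Ioi (0 : ℝ), ENNReal.ofReal (t ^ (P - 2)) *
        ∫⁻ x, (if t < N x then ENNReal.ofReal (N x) else 0) ∂μ
      = ENNReal.ofReal (1 / (P - 1)) * ∫⁻ x, ENNReal.ofReal (N x ^ P) ∂μ := by
  have hP1 : 0 < P - 1 := by linarith
  have hm : Measurable (Function.uncurry fun (t : ℝ) (x : Ω) =>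
      ENNReal.ofReal (t ^ (P - 2)) * (if t < N x then ENNReal.ofReal (N x) else 0)) := by
    refine Measurable.mul (by fun_prop) (Measurable.ite ?_ (by fun_prop) measurable_const)
    exact measurableSet_lt measurable_fst (hN.comp measurable_snd)
  have h1 : ∀ t : ℝ, ENNReal.ofReal (t ^ (P - 2)) *
        ∫⁻ x, (if t < N x then ENNReal.ofReal (N x) else 0) ∂μ
      = ∫⁻ x, ENNReal.ofReal (t ^ (P - 2)) * (if t < N x then ENNReal.ofReal (N x) else 0) ∂μ :=
    fun t => (lintegral_const_mul _ (Measurable.ite (measurableSet_lt measurable_const hN)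
      (by fun_prop) measurable_const)).symm
  simp_rw [h1]
  rw [lintegral_lintegral_swap hm.aemeasurable, ← lintegral_const_mul _ (by fun_prop)]
  refine lintegral_congr fun x => ?_
  have h2 : ∀ t : ℝ, ENNReal.ofReal (t ^ (P - 2)) * (if t < N x then ENNReal.ofReal (N x) else 0)
      = ENNReal.ofReal (N x) * (if t < N x then ENNReal.ofReal (t ^ (P - 2)) else 0) := by
    intro t; split_ifs
    · rw [mul_comm]
    · simp
  simp_rw [h2]
  rw [lintegral_const_mul' _ _ ENNReal.ofReal_ne_top,
    lintegral_Ioi_indicator_lt_rpow (by linarith) (hN0 x), ← ENNReal.ofReal_mul (hN0 x),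
    ← ENNReal.ofReal_mul (by positivity)]
  congr 1
  rcases (hN0 x).eq_or_lt with h | h
  · rw [← h, Real.zero_rpow (by linarith : P ≠ 0)]; simp
  · have h3 : P - 2 + 1 = P - 1 := by ring
    rw [h3, Real.rpow_sub_one h.ne']
    field_simp

theorem lintegral_truncate_below {N : Ω → ℝ} (hN : Measurable N) (hN0 : ∀ x, 0 ≤ N x) {P : ℝ}
    (hP0 : 0 < P) (hP : P < 2) :
    ∫⁻ t in Set.Ioi (0 : ℝ), ENNReal.ofReal (t ^ (P - 3)) *
        ∫⁻ x, (if N x ≤ t then ENNReal.ofReal (N x ^ 2) else 0) ∂μ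
      = ENNReal.ofReal (1 / (2 - P)) * ∫⁻ x, ENNReal.ofReal (N x ^ P) ∂μ := by
  have hP1 : 0 < 2 - P := by linarith
  have hm : Measurable (Function.uncurry fun (t : ℝ) (x : Ω) =>
      ENNReal.ofReal (t ^ (P - 3)) * (if N x ≤ t then ENNReal.ofReal (N x ^ 2) else 0)) := by
    refine Measurable.mul (by fun_prop) (Measurable.ite ?_ (by fun_prop) measurable_const)
    exact measurableSet_le (hN.comp measurable_snd) measurable_fst
  have h1 : ∀ t : ℝ, ENNReal.ofReal (t ^ (P - 3)) *
        ∫⁻ x, (if N x ≤ t then ENNReal.ofReal (N x ^ 2) else 0) ∂μ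
      = ∫⁻ x, ENNReal.ofReal (t ^ (P - 3)) *
        (if N x ≤ t then ENNReal.ofReal (N x ^ 2) else 0) ∂μ :=
    fun t => (lintegral_const_mul _ (Measurable.ite (measurableSet_le hN measurable_const)
      (by fun_prop) measurable_const)).symm
  simp_rw [h1]
  rw [lintegral_lintegral_swap hm.aemeasurable, ← lintegral_const_mul _ (by fun_prop)]
  refine lintegral_congr fun x => ?_
  have h2 : ∀ t : ℝ, ENNReal.ofReal (t ^ (P - 3)) *
        (if N x ≤ t then ENNReal.ofReal (N x ^ 2) else 0)
      = ENNReal.ofReal (N x ^ 2) * (if N x ≤ t then ENNReal.ofReal (t ^ (P - 3)) else 0) := by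
    intro t; split_ifs
    · rw [mul_comm]
    · simp
  simp_rw [h2]
  rw [lintegral_const_mul' _ _ ENNReal.ofReal_ne_top]
  rcases (hN0 x).eq_or_lt with h | h
  · rw [← h, Real.zero_rpow hP0.ne']; simp
  · rw [lintegral_Ioi_indicator_le_rpow (by linarith) h, ← ENNReal.ofReal_mul (by positivity),
      ← ENNReal.ofReal_mul (by positivity)]
    congr 1
    have : N x ^ P = N x ^ 2 * N x ^ (P - 3 + 1) := by
      rw [← Real.rpow_natCast, ← Real.rpow_add h]; congr 1; push_cast; ring
    rw [this]
    have h3 : P - 3 + 1 = -(2 - P) := by ring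
    rw [h3]
    field_simp

/-- Paley's inequality for Hilbert-space-valued functions, with weights of weak type. -/
theorem IsBddOrthonormal.paley_of_lt_two (hφ : IsBddOrthonormal μ φ) {ω : ι → ℝ}
    (hω : ∀ i, 0 < ω i) {K : ℝ} (hK : 0 ≤ K)
    (hωK : ∀ t > 0, ∑ i with t < ω i, (ω i ^ 2)⁻¹ ≤ K / t) {P : ℝ} (hP1 : 1 < P) (hP2 : P < 2)
    (v : ι → H) :
    ∑ i, ENNReal.ofReal (ω i ^ (P - 2)) * ‖v i‖ₑ ^ P
      ≤ ENNReal.ofReal (2 ^ P * P * (K * (1 / (P - 1)) + 1 / (2 - P))) *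
        ∫⁻ x, ‖∑ i, φ i x • v i‖ₑ ^ P ∂μ := by
  have hP0 : 0 < P := by linarith
  set N : Ω → ℝ := fun x => ‖∑ i, φ i x • v i‖ with hN
  have hNm : Measurable N := (hφ.stronglyMeasurable_sum v).norm.measurable
  have hN0 : ∀ x, 0 ≤ N x := fun x => norm_nonneg _
  have hNB : ∀ x, N x ≤ ∑ i, ‖v i‖ := hφ.norm_sum_le v
  have hB0 : 0 ≤ ∑ i, ‖v i‖ := Finset.sum_nonneg fun i _ => norm_nonneg _
  have hen : ∀ w : H, ‖w‖ₑ ^ P = ENNReal.ofReal (‖w‖ ^ P) := fun w => by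
    rw [← ofReal_norm, ENNReal.ofReal_rpow_of_nonneg (norm_nonneg _) hP0.le]
  simp_rw [hen]
  have hterm : ∀ i, ENNReal.ofReal (ω i ^ (P - 2)) * ENNReal.ofReal (‖v i‖ ^ P)
      = ∫⁻ t in Set.Ioi (0 : ℝ), ENNReal.ofReal (2 ^ P * P * (ω i ^ 2)⁻¹) *
        (if t < ω i * ‖v i‖ / 2 then ENNReal.ofReal (t ^ (P - 1)) else 0) := by
    intro i
    have hwi := hω i
    rw [lintegral_const_mul' _ _ ENNReal.ofReal_ne_top, lintegral_Ioi_indicator_lt_rpow (by linarith)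
      (by positivity), ← ENNReal.ofReal_mul (by positivity), ← ENNReal.ofReal_mul (by positivity)]
    congr 1
    rw [show P - 1 + 1 = P by ring, Real.div_rpow (by positivity) (by positivity),
      Real.mul_rpow hwi.le (norm_nonneg _), Real.rpow_sub hwi, Real.rpow_two]
    field_simp
  simp_rw [hterm]
  have hmeas : ∀ i ∈ Finset.univ, Measurable fun t : ℝ =>
      ENNReal.ofReal (2 ^ P * P * (ω i ^ 2)⁻¹) *
        (if t < ω i * ‖v i‖ / 2 then ENNReal.ofReal (t ^ (P - 1)) else 0) := fun i _ =>
    (Measurable.ite (measurableSet_lt measurable_id measurable_const)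
      (by fun_prop) measurable_const).const_mul _
  rw [← lintegral_finsetSum _ hmeas]
  have hA : ∀ t : ℝ, ENNReal.ofReal (∫ x, (if t < N x then N x else 0) ∂μ)
      = ∫⁻ x, (if t < N x then ENNReal.ofReal (N x) else 0) ∂μ := by
    intro t
    rw [ofReal_integral_eq_lintegral_ofReal]
    · refine lintegral_congr fun x => ?_
      split_ifs <;> simp
    · refine integrable_of_norm_le (B := ∑ i, ‖v i‖) (Measurable.ite (measurableSet_lt
        measurable_const hNm) hNm measurable_const).aestronglyMeasurable fun x => ?_
      split_ifs
      · rw [Real.norm_of_nonneg (hN0 x)]; exact hNB x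
      · simpa using hB0
    · exact Filter.Eventually.of_forall fun x => by dsimp only; split_ifs <;> simp [hN0 x]
  have hB : ∀ t : ℝ, ENNReal.ofReal (∫ x, (if N x ≤ t then N x ^ 2 else 0) ∂μ)
      = ∫⁻ x, (if N x ≤ t then ENNReal.ofReal (N x ^ 2) else 0) ∂μ := by
    intro t
    rw [ofReal_integral_eq_lintegral_ofReal]
    · refine lintegral_congr fun x => ?_
      split_ifs <;> simp
    · refine integrable_of_norm_le (B := (∑ i, ‖v i‖) ^ 2) (Measurable.ite (measurableSet_le
        hNm measurable_const) (hNm.pow_const 2) measurable_const).aestronglyMeasurable fun x => ?_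
      split_ifs
      · rw [norm_pow, Real.norm_of_nonneg (hN0 x)]
        exact pow_le_pow_left₀ (hN0 x) (hNB x) 2
      · simpa using sq_nonneg (∑ i, ‖v i‖)
    · exact Filter.Eventually.of_forall fun x => by dsimp only; split_ifs <;> simp [sq_nonneg]
  have hpt : ∀ t ∈ Set.Ioi (0 : ℝ), ∑ i, ENNReal.ofReal (2 ^ P * P * (ω i ^ 2)⁻¹) *
        (if t < ω i * ‖v i‖ / 2 then ENNReal.ofReal (t ^ (P - 1)) else 0)
      ≤ ENNReal.ofReal (2 ^ P * P) * (ENNReal.ofReal K * (ENNReal.ofReal (t ^ (P - 2)) *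
          ∫⁻ x, (if t < N x then ENNReal.ofReal (N x) else 0) ∂μ)
        + ENNReal.ofReal (t ^ (P - 3)) *
          ∫⁻ x, (if N x ≤ t then ENNReal.ofReal (N x ^ 2) else 0) ∂μ) := by
    intro t ht
    have ht : 0 < t := ht
    have hw := hφ.sum_weight_le hω hωK v ht
    change _ ≤ K * t⁻¹ * ∫ x, (if t < N x then N x else 0) ∂μ
      + (t ^ 2)⁻¹ * ∫ x, (if N x ≤ t then N x ^ 2 else 0) ∂μ at hw
    have hA0 : 0 ≤ ∫ x, (if t < N x then N x else 0) ∂μ :=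
      integral_nonneg fun x => by dsimp only; split_ifs <;> simp [hN0 x]
    have hB0 : 0 ≤ ∫ x, (if N x ≤ t then N x ^ 2 else 0) ∂μ :=
      integral_nonneg fun x => by dsimp only; split_ifs <;> simp [sq_nonneg]
    have hl : ∑ i, ENNReal.ofReal (2 ^ P * P * (ω i ^ 2)⁻¹) *
        (if t < ω i * ‖v i‖ / 2 then ENNReal.ofReal (t ^ (P - 1)) else 0)
        = ENNReal.ofReal (2 ^ P * P * t ^ (P - 1) *
          ∑ i with t < ω i * ‖v i‖ / 2, (ω i ^ 2)⁻¹) := by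
      rw [Finset.sum_filter, Finset.mul_sum, ENNReal.ofReal_sum_of_nonneg]
      · refine Finset.sum_congr rfl fun i _ => ?_
        split_ifs
        · rw [← ENNReal.ofReal_mul (by have := hω i; positivity)]; congr 1; ring
        · simp
      · intro i _
        split_ifs
        · have := hω i; positivity
        · simp
    rw [hl, ← hA, ← hB, ← ENNReal.ofReal_mul (by positivity), ← ENNReal.ofReal_mul hK,
      ← ENNReal.ofReal_mul (by positivity), ← ENNReal.ofReal_add (by positivity) (by positivity),
      ← ENNReal.ofReal_mul (by positivity)]
    refine ENNReal.ofReal_le_ofReal ?_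
    have e1 : t ^ (P - 2) = t ^ (P - 1) * t⁻¹ := by
      rw [show P - 2 = P - 1 - 1 by ring, Real.rpow_sub_one ht.ne']; rfl
    have e2 : t ^ (P - 3) = t ^ (P - 1) * (t ^ 2)⁻¹ := by
      rw [show P - 3 = P - 1 - 2 by ring, Real.rpow_sub ht, Real.rpow_two]; rfl
    calc _ ≤ 2 ^ P * P * t ^ (P - 1) * (K * t⁻¹ * ∫ x, (if t < N x then N x else 0) ∂μ
      + (t ^ 2)⁻¹ * ∫ x, (if N x ≤ t then N x ^ 2 else 0) ∂μ) := by gcongr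
      _ = _ := by rw [e1, e2]; ring
  refine (setLIntegral_mono' measurableSet_Ioi hpt).trans (le_of_eq ?_)
  have hmA : Measurable fun t : ℝ => ENNReal.ofReal (t ^ (P - 2)) *
      ∫⁻ x, (if t < N x then ENNReal.ofReal (N x) else 0) ∂μ := by
    refine Measurable.mul (by fun_prop) (Measurable.lintegral_prod_right' (f := fun z : ℝ × Ω =>
      if z.1 < N z.2 then ENNReal.ofReal (N z.2) else 0) ?_)
    exact Measurable.ite (measurableSet_lt measurable_fst (hNm.comp measurable_snd))
      (by fun_prop) measurable_const
  rw [lintegral_const_mul' _ _ ENNReal.ofReal_ne_top, lintegral_add_left (hmA.const_mul _),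
    lintegral_const_mul' _ _ ENNReal.ofReal_ne_top, lintegral_truncate_above hNm hN0 hP1,
    lintegral_truncate_below hNm hN0 hP0 hP2, ← mul_assoc, ← add_mul, ← mul_assoc,
    ← ENNReal.ofReal_mul hK, ← ENNReal.ofReal_add, ← ENNReal.ofReal_mul (by positivity)]
  · have : 0 < P - 1 := by linarith
    positivity
  · have : 0 < 2 - P := by linarith
    positivity

theorem IsBddOrthonormal.paley_two (hφ : IsBddOrthonormal μ φ) (v : ι → H) :
    ∑ i, ‖v i‖ₑ ^ (2 : ℝ) = ∫⁻ x, ‖∑ i, φ i x • v i‖ₑ ^ (2 : ℝ) ∂μ := by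
  have hen : ∀ w : H, ‖w‖ₑ ^ (2 : ℝ) = ENNReal.ofReal (‖w‖ ^ 2) := fun w => by
    rw [← ofReal_norm, ENNReal.ofReal_rpow_of_nonneg (norm_nonneg _) (by norm_num), Real.rpow_two]
  simp_rw [hen]
  rw [← ENNReal.ofReal_sum_of_nonneg fun i _ => sq_nonneg _, ← hφ.integral_norm_sq v,
    ofReal_integral_eq_lintegral_ofReal _ (Filter.Eventually.of_forall fun x => sq_nonneg _)]
  refine integrable_of_norm_le (B := (∑ i, ‖v i‖) ^ 2)
    ((hφ.stronglyMeasurable_sum v).norm.pow 2).aestronglyMeasurable fun x => ?_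
  rw [norm_pow, norm_norm]
  exact pow_le_pow_left₀ (norm_nonneg _) (hφ.norm_sum_le v x) 2

/-- Paley's inequality for `1 < P ≤ 2` with a constant depending only on `P` and `K`. -/
theorem exists_paley_const {P : ℝ} (hP1 : 1 < P) (hP2 : P ≤ 2) {K : ℝ} (hK : 0 ≤ K) :
    ∃ C : ℝ, 0 ≤ C ∧ ∀ {Ω ι H : Type} [MeasurableSpace Ω] [Fintype ι] [DecidableEq ι]
      {μ : Measure Ω} [IsProbabilityMeasure μ] [NormedAddCommGroup H] [InnerProductSpace ℂ H]
      [CompleteSpace H] {φ : ι → Ω → ℂ}, IsBddOrthonormal μ φ → ∀ {ω : ι → ℝ},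
      (∀ i, 0 < ω i) → (∀ t > 0, ∑ i with t < ω i, (ω i ^ 2)⁻¹ ≤ K / t) → ∀ v : ι → H,
      ∑ i, ENNReal.ofReal (ω i ^ (P - 2)) * ‖v i‖ₑ ^ P
        ≤ ENNReal.ofReal C * ∫⁻ x, ‖∑ i, φ i x • v i‖ₑ ^ P ∂μ := by
  rcases hP2.eq_or_lt with rfl | h
  · refine ⟨1, zero_le_one, ?_⟩
    intro Ω ι H _ _ _ μ _ _ _ _ φ hφ ω _ _ v
    simpa using (hφ.paley_two v).le
  · refine ⟨2 ^ P * P * (K * (1 / (P - 1)) + 1 / (2 - P)), ?_, ?_⟩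
    · have : 0 < P - 1 := by linarith
      have : 0 < 2 - P := by linarith
      positivity
    · intro Ω ι H _ _ _ μ _ _ _ _ φ hφ ω hω hωK v
      exact hφ.paley_of_lt_two hω hK hωK hP1 h v

end Paley

theorem sum_fin_succ_pi {ι M : Type*} [Fintype ι] [AddCommMonoid M] {d : ℕ}
    (F : (Fin (d + 1) → ι) → M) :
    ∑ k, F k = ∑ k' : Fin d → ι, ∑ a, F (Fin.cons a k') := by
  rw [Finset.sum_comm, ← Fintype.sum_prod_type' (f := fun a k' => F (Fin.cons a k'))]
  exact (Fintype.sum_equiv (Fin.consEquiv fun _ => ι) _ _ fun _ => rfl).symm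

theorem lintegral_fin_succ_pi {Ω : Type*} [MeasurableSpace Ω] {μ : Measure Ω} [SigmaFinite μ]
    {d : ℕ} {F : (Fin (d + 1) → Ω) → ℝ≥0∞} (hF : Measurable F) :
    ∫⁻ x, F x ∂(Measure.pi fun _ => μ)
      = ∫⁻ x₀, ∫⁻ x' : Fin d → Ω, F (Fin.cons x₀ x') ∂(Measure.pi fun _ => μ) ∂μ := by
  have h := (measurePreserving_piFinSuccAbove (fun _ : Fin (d + 1) => μ) 0).symm
  have hm : Measurable fun z : Ω × (Fin d → Ω) =>
      F ((MeasurableEquiv.piFinSuccAbove (fun _ => Ω) 0).symm z) :=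
    hF.comp (MeasurableEquiv.measurable _)
  rw [← h.lintegral_comp hF, lintegral_prod _ hm.aemeasurable]
  refine lintegral_congr fun x => lintegral_congr fun y => congrArg F ?_
  exact Fin.insertNth_zero' x y

/-- Tensorization of a one-dimensional weighted coefficient inequality. -/
theorem sum_prod_weight_le {Ω ι H : Type*} [MeasurableSpace Ω] {μ : Measure Ω} [SigmaFinite μ]
    [Fintype ι] [NormedAddCommGroup H] [NormedSpace ℂ H] {φ : ι → Ω → ℂ}
    (hφ : ∀ i, Measurable (φ i)) {w : ι → ℝ≥0∞} {C : ℝ≥0∞} {P : ℝ}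
    (h : ∀ v : ι → H, ∑ i, w i * ‖v i‖ₑ ^ P ≤ C * ∫⁻ x, ‖∑ i, φ i x • v i‖ₑ ^ P ∂μ) (d : ℕ)
    (v : (Fin d → ι) → H) :
    ∑ k, (∏ i, w (k i)) * ‖v k‖ₑ ^ P
      ≤ C ^ d * ∫⁻ x, ‖∑ k, (∏ i, φ (k i) (x i)) • v k‖ₑ ^ P ∂(Measure.pi fun _ => μ) := by
  induction d with
  | zero => simp
  | succ d ih =>
    have hmeas : Measurable fun x : Fin (d + 1) → Ω =>
        ‖∑ k : Fin (d + 1) → ι, (∏ i, φ (k i) (x i)) • v k‖ₑ ^ P := by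
      refine Measurable.pow_const (StronglyMeasurable.enorm
        (Finset.stronglyMeasurable_fun_sum _ fun k _ => ?_)) _
      refine (Measurable.stronglyMeasurable ?_).smul_const (v k)
      exact Finset.measurable_fun_prod _ fun i _ => (hφ (k i)).comp (measurable_pi_apply i)
    have hmeas1 : ∀ k' : Fin d → ι,
        Measurable fun x => ‖∑ a, φ a x • v (Fin.cons a k' : Fin (d + 1) → ι)‖ₑ ^ P := fun k' =>
      Measurable.pow_const (StronglyMeasurable.enorm (Finset.stronglyMeasurable_fun_sum _ fun a _ =>
        (hφ a).stronglyMeasurable.smul_const _)) _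
    rw [lintegral_fin_succ_pi hmeas, sum_fin_succ_pi]
    calc ∑ k' : Fin d → ι, ∑ a, (∏ i, w ((Fin.cons a k' : Fin (d + 1) → ι) i)) *
            ‖v (Fin.cons a k')‖ₑ ^ P
        = ∑ k' : Fin d → ι, (∏ i, w (k' i)) * ∑ a, w a * ‖v (Fin.cons a k')‖ₑ ^ P := by
          refine Finset.sum_congr rfl fun k' _ => ?_
          rw [Finset.mul_sum]
          refine Finset.sum_congr rfl fun a _ => ?_
          rw [Fin.prod_univ_succ]
          simp only [Fin.cons_zero, Fin.cons_succ]
          ring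
      _ ≤ ∑ k' : Fin d → ι, (∏ i, w (k' i)) *
            (C * ∫⁻ x, ‖∑ a, φ a x • v (Fin.cons a k')‖ₑ ^ P ∂μ) := by
          gcongr with k' _
          exact h _
      _ = C * ∫⁻ x₀, ∑ k' : Fin d → ι, (∏ i, w (k' i)) *
            ‖∑ a, φ a x₀ • v (Fin.cons a k')‖ₑ ^ P ∂μ := by
          rw [lintegral_finsetSum _ fun k' _ => (hmeas1 k').const_mul _, Finset.mul_sum]
          refine Finset.sum_congr rfl fun k' _ => ?_
          rw [lintegral_const_mul _ (hmeas1 k')]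
          ring
      _ ≤ C * ∫⁻ x₀, C ^ d * ∫⁻ x', ‖∑ k' : Fin d → ι, (∏ i, φ (k' i) (x' i)) •
            ∑ a, φ a x₀ • v (Fin.cons a k')‖ₑ ^ P ∂(Measure.pi fun _ => μ) ∂μ := by
          gcongr with x₀
          exact ih fun k' => ∑ a, φ a x₀ • v (Fin.cons a k')
      _ = C * ∫⁻ x₀, C ^ d * ∫⁻ x' : Fin d → Ω, ‖∑ k : Fin (d + 1) → ι,
            (∏ i, φ (k i) ((Fin.cons x₀ x' : Fin (d + 1) → Ω) i)) • v k‖ₑ ^ P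
            ∂(Measure.pi fun _ => μ) ∂μ := by
          congr! 8 with x₀ x'
          rw [sum_fin_succ_pi]
          refine Finset.sum_congr rfl fun k' _ => ?_
          rw [Finset.smul_sum]
          refine Finset.sum_congr rfl fun a _ => ?_
          rw [Fin.prod_univ_succ, smul_smul]
          simp only [Fin.cons_zero, Fin.cons_succ]
          rw [mul_comm]
      _ = _ := by
          have hm2 : Measurable fun x₀ => ∫⁻ x' : Fin d → Ω, ‖∑ k : Fin (d + 1) → ι,
              (∏ i, φ (k i) ((Fin.cons x₀ x' : Fin (d + 1) → Ω) i)) • v k‖ₑ ^ P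
              ∂(Measure.pi fun _ => μ) := by
            refine Measurable.lintegral_prod_right' (f := fun z : Ω × (Fin d → Ω) =>
              ‖∑ k : Fin (d + 1) → ι,
              (∏ i, φ (k i) ((Fin.cons z.1 z.2 : Fin (d + 1) → Ω) i)) • v k‖ₑ ^ P) ?_
            refine hmeas.comp (measurable_pi_lambda _ fun i => ?_)
            refine Fin.cases ?_ (fun j => ?_) i
            · exact measurable_fst
            · exact (measurable_pi_apply j).comp measurable_snd
          rw [lintegral_const_mul _ hm2]
          ring

/-- The one-dimensional character. -/
def chr (k : ℤ) (x : ℝ) : ℂ := Complex.exp (((2 * Real.pi * (k * x) : ℝ) : ℂ) * Complex.I)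

theorem expk_eq_prod (d : ℕ) (k : Fin d → ℤ) (x : Fin d → ℝ) :
    expk d k x = ∏ i, chr (k i) (x i) := by
  simp only [expk, chr]
  rw [← Complex.exp_sum, ← Finset.sum_mul, Finset.mul_sum]
  push_cast
  rfl

theorem norm_chr (k : ℤ) (x : ℝ) : ‖chr k x‖ = 1 := Complex.norm_exp_ofReal_mul_I _

theorem continuous_chr (k : ℤ) : Continuous (chr k) := by unfold chr; fun_prop

theorem chr_add (k l : ℤ) (x : ℝ) : chr (k + l) x = chr k x * chr l x := by
  simp only [chr]; rw [← Complex.exp_add]; congr 1; push_cast; ring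

theorem conj_chr (k : ℤ) (x : ℝ) : starRingEnd ℂ (chr k x) = chr (-k) x := by
  simp only [chr]; rw [← Complex.exp_conj, map_mul, Complex.conj_ofReal, Complex.conj_I]
  congr 1
  push_cast
  ring

theorem chr_zero (x : ℝ) : chr 0 x = 1 := by simp [chr]

/-- The measure on the one-dimensional fundamental domain. -/
abbrev unitMeasure : Measure ℝ := volume.restrict (Set.Ico 0 1)

instance : IsProbabilityMeasure unitMeasure := ⟨by simp⟩

theorem integral_chr (k : ℤ) : ∫ x, chr k x ∂unitMeasure = if k = 0 then 1 else 0 := by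
  split_ifs with h
  · subst h; simp [chr_zero]
  · rw [unitMeasure, Measure.restrict_congr_set Ico_ae_eq_Ioc, ← intervalIntegral.integral_of_le zero_le_one]
    have hc : (2 * Real.pi * k * Complex.I : ℂ) ≠ 0 := by
      simp [Real.pi_ne_zero, h]
    have : ∀ x : ℝ, chr k x = Complex.exp ((2 * Real.pi * k * Complex.I : ℂ) * x) := fun x => by
      simp only [chr]; congr 1; push_cast; ring
    simp_rw [this]
    rw [integral_exp_mul_complex hc]
    have h1 : (2 * Real.pi * k * Complex.I : ℂ) * (1 : ℝ) = k * (2 * Real.pi * Complex.I) := by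
      push_cast; ring
    rw [h1, Complex.exp_int_mul_two_pi_mul_I]
    simp

theorem restrict_cube (d : ℕ) :
    (volume.restrict (cube d) : Measure (Fin d → ℝ)) = Measure.pi fun _ => unitMeasure := by
  rw [cube, volume_pi, Measure.restrict_pi_pi]

theorem isBddOrthonormal_chr {ι : Type*} [DecidableEq ι] {q : ι → ℤ}
    (hq : Function.Injective q) : IsBddOrthonormal unitMeasure fun i => chr (q i) where
  meas i := (continuous_chr _).measurable
  norm_le i x := (norm_chr _ _).le
  orth i j := by
    simp_rw [conj_chr, ← chr_add]
    rw [integral_chr]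
    by_cases h : i = j
    · simp [h]
    · have : ¬ (-q i + q j = 0) := fun h' => h (hq (by omega))
      simp [h, this]

theorem continuous_expk (d : ℕ) (k : Fin d → ℤ) : Continuous (expk d k) := by
  unfold expk; fun_prop

theorem norm_expk (d : ℕ) (k : Fin d → ℤ) (x : Fin d → ℝ) : ‖expk d k x‖ = 1 :=
  Complex.norm_exp_ofReal_mul_I _

theorem integral_expk_mul (d : ℕ) (k l : Fin d → ℤ) :
    ∫ x in cube d, expk d k x * expk d (-l) x = if k = l then 1 else 0 := by
  have : ∀ x : Fin d → ℝ, expk d k x * expk d (-l) x = ∏ i, chr (k i - l i) (x i) := fun x => by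
    rw [expk_eq_prod, expk_eq_prod, ← Finset.prod_mul_distrib]
    refine Finset.prod_congr rfl fun i _ => ?_
    rw [← chr_add]; rfl
  simp_rw [this]
  rw [restrict_cube, integral_fintype_prod_eq_prod (f := fun i => chr (k i - l i))]
  simp_rw [integral_chr, sub_eq_zero]
  by_cases h : k = l
  · simp [h]
  · rw [if_neg h]
    obtain ⟨i, hi⟩ := Function.ne_iff.1 h
    exact Finset.prod_eq_zero (Finset.mem_univ i) (if_neg hi)

instance (d : ℕ) : IsProbabilityMeasure (volume.restrict (cube d)) := by
  rw [restrict_cube]; infer_instance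

theorem integrableOn_trigPoly (d : ℕ) (Λ : Finset (Fin d → ℤ)) (a : (Fin d → ℤ) → ℂ) :
    IntegrableOn (fun x => ∑ k ∈ Λ, a k * expk d k x) (cube d) := by
  refine integrable_finsetSum _ fun k _ => integrable_of_norm_le (B := ‖a k‖) ?_ fun x => ?_
  · exact ((continuous_expk d k).const_mul _).aestronglyMeasurable
  · simp [norm_expk]

theorem integrableOn_mul_expk {d : ℕ} {f : (Fin d → ℝ) → ℂ} (hf : IntegrableOn f (cube d))
    (k : Fin d → ℤ) : IntegrableOn (fun x => f x * expk d k x) (cube d) :=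
  Integrable.mul_bdd (c := 1) hf (continuous_expk d k).aestronglyMeasurable
    (Filter.Eventually.of_forall fun x => (norm_expk d k x).le)

theorem fCoeff_trigPoly (d : ℕ) (Λ : Finset (Fin d → ℤ)) (a : (Fin d → ℤ) → ℂ) (l : Fin d → ℤ) :
    fCoeff d (fun x => ∑ k ∈ Λ, a k * expk d k x) l = if l ∈ Λ then a l else 0 := by
  simp only [fCoeff, Finset.sum_mul, mul_assoc]
  rw [integral_finsetSum]
  · simp_rw [integral_const_mul, integral_expk_mul]
    simp
  · intro k _
    have := integrableOn_mul_expk (integrableOn_trigPoly d {k} a) (-l)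
    simpa [IntegrableOn, mul_assoc] using this

theorem fCoeff_sub {d : ℕ} {f g : (Fin d → ℝ) → ℂ} (hf : IntegrableOn f (cube d))
    (hg : IntegrableOn g (cube d)) (k : Fin d → ℤ) :
    fCoeff d (f - g) k = fCoeff d f k - fCoeff d g k := by
  simp only [fCoeff, Pi.sub_apply, sub_mul]
  exact integral_sub (integrableOn_mul_expk hf _) (integrableOn_mul_expk hg _)

/-- The index of the dyadic block containing `k`. -/
def lev (k : ℤ) : ℕ := Nat.size k.natAbs

theorem mem_blockF {k : ℤ} {n : ℕ} : k ∈ blockF n ↔ lev k = n := by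
  have habs : |k| = (k.natAbs : ℤ) := Int.abs_eq_natAbs k
  have hpow : ∀ a : ℕ, ((2 : ℤ) ^ a ≤ |k| ↔ 2 ^ a ≤ k.natAbs) ∧
      (|k| < (2 : ℤ) ^ a ↔ k.natAbs < 2 ^ a) := fun a => by
    rw [habs]; constructor <;> norm_cast
  have hs : lev k ≤ n ↔ k.natAbs < 2 ^ n := Nat.size_le
  simp only [blockF, Finset.mem_filter, Finset.mem_Icc, (hpow _).1, (hpow _).2]
  constructor
  · rintro ⟨-, ⟨rfl, rfl⟩ | ⟨hn, h1, h2⟩⟩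
    · simp [lev]
    · have h3 : n - 1 < lev k := Nat.lt_size.2 h1
      have := hs.2 h2
      omega
  · intro h
    have h2 := hs.1 h.le
    have h3 := (hpow n).2.2 h2
    refine ⟨abs_le.1 h3.le, ?_⟩
    by_cases hn : n = 0
    · left; subst hn; simpa using h2
    · refine Or.inr ⟨hn, Nat.lt_size.1 ?_, h2⟩
      change n - 1 < lev k
      omega

theorem card_blockF_le (n : ℕ) : (blockF n).card ≤ 3 * 2 ^ n := by
  refine (Finset.card_filter_le _ _).trans ?_
  rw [Int.card_Icc]
  have : ((2 : ℤ) ^ n) = ((2 ^ n : ℕ) : ℤ) := by norm_cast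
  rw [this]
  have := Nat.one_le_two_pow (n := n)
  omega

theorem sum_half_pow_le {t : ℝ} (ht : 0 < t) (M : ℕ) :
    ∑ n ∈ Finset.range M, (if t < (2 : ℝ) ^ n then ((2 : ℝ) ^ n)⁻¹ else 0)
      ≤ max 0 (2 / t - 2 * ((2 : ℝ) ^ M)⁻¹) := by
  induction M with
  | zero => simp
  | succ M ih =>
    rw [Finset.sum_range_succ]
    have h2 : (0 : ℝ) < 2 ^ M := by positivity
    have e : ((2 : ℝ) ^ (M + 1))⁻¹ = (2 ^ M)⁻¹ / 2 := by rw [pow_succ, mul_inv]; ring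
    rw [e]
    split_ifs with h
    · have h3 : ((2 : ℝ) ^ M)⁻¹ < t⁻¹ := inv_strictAnti₀ ht h
      have h4 : 0 < ((2 : ℝ) ^ M)⁻¹ := by positivity
      have h5 : 2 / t = 2 * t⁻¹ := rfl
      refine le_max_of_le_right ?_
      rcases max_choice 0 (2 / t - 2 * ((2 : ℝ) ^ M)⁻¹) with h6 | h6 <;> rw [h6] at ih <;> linarith
    · rw [add_zero]
      refine ih.trans (max_le_max le_rfl ?_)
      have h4 : 0 < ((2 : ℝ) ^ M)⁻¹ := by positivity
      linarith

/-- The dyadic weights satisfy the weak-type condition of Paley's inequality. -/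
theorem sum_lev_weight_le {ι : Type*} [Fintype ι] {q : ι → ℤ}
    (hq : Function.Injective q) {t : ℝ} (ht : 0 < t) :
    ∑ i with t < (2 : ℝ) ^ lev (q i), (((2 : ℝ) ^ lev (q i)) ^ 2)⁻¹ ≤ 6 / t := by
  classical
  obtain ⟨M, hM⟩ : ∃ M, ∀ i, lev (q i) < M :=
    ⟨(Finset.univ.sup fun i => lev (q i)) + 1, fun i =>
      Nat.lt_succ_of_le (Finset.le_sup (f := fun i => lev (q i)) (Finset.mem_univ i))⟩
  rw [Finset.sum_filter, ← Finset.sum_fiberwise_of_maps_to (t := Finset.range M)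
    (g := fun i => lev (q i)) fun i _ => Finset.mem_range.2 (hM i)]
  have hcard : ∀ n, (Finset.univ.filter fun i => lev (q i) = n).card ≤ 3 * 2 ^ n := fun n => by
    refine le_trans ?_ (card_blockF_le n)
    refine Finset.card_le_card_of_injOn q (fun i hi => ?_) hq.injOn
    exact mem_blockF.2 (by simpa using hi)
  calc _ ≤ ∑ n ∈ Finset.range M, 3 * (if t < (2 : ℝ) ^ n then ((2 : ℝ) ^ n)⁻¹ else 0) := by
        refine Finset.sum_le_sum fun n _ => ?_
        calc _ = ∑ i with lev (q i) = n, (if t < (2 : ℝ) ^ n then (((2 : ℝ) ^ n) ^ 2)⁻¹ else 0) := by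
              refine Finset.sum_congr rfl fun i hi => ?_
              rw [(Finset.mem_filter.1 hi).2]
          _ = ((Finset.univ.filter fun i => lev (q i) = n).card : ℝ) *
                (if t < (2 : ℝ) ^ n then (((2 : ℝ) ^ n) ^ 2)⁻¹ else 0) := by
              rw [Finset.sum_const, nsmul_eq_mul]
          _ ≤ (3 * 2 ^ n) * (if t < (2 : ℝ) ^ n then (((2 : ℝ) ^ n) ^ 2)⁻¹ else 0) := by
              refine mul_le_mul_of_nonneg_right (by exact_mod_cast hcard n) ?_
              split_ifs <;> positivity
          _ = _ := by
              split_ifs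
              · field_simp
              · simp
    _ ≤ 3 * (2 / t) := by
        rw [← Finset.mul_sum]
        refine mul_le_mul_of_nonneg_left ((sum_half_pow_le ht M).trans (max_le (by positivity) ?_))
          (by norm_num)
        have : 0 < ((2 : ℝ) ^ M)⁻¹ := by positivity
        linarith
    _ = 6 / t := by ring

/-- The order of the dyadic block of a multi-index. -/
def tlev {d : ℕ} (k : Fin d → ℤ) : ℕ := ∑ i, lev (k i)

theorem enorm_eq_coord_rpow {κ : Type*} [Fintype κ] (w : EuclideanSpace ℂ κ) :
    ‖w‖ₑ = (∑ j, ‖w j‖ₑ ^ 2) ^ ((1 : ℝ) / 2) := by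
  rw [← ofReal_norm, EuclideanSpace.norm_eq, Real.sqrt_eq_rpow,
    ← ENNReal.ofReal_rpow_of_nonneg (Finset.sum_nonneg fun j _ => sq_nonneg _) (by norm_num),
    ENNReal.ofReal_sum_of_nonneg fun j _ => sq_nonneg _]
  simp_rw [ENNReal.ofReal_pow (norm_nonneg _), ofReal_norm]

theorem smul_single_apply {κ : Type*} [Fintype κ] [DecidableEq κ] (b : ℂ) (J j : κ) (a : ℂ) :
    (a • b • EuclideanSpace.single J (1 : ℂ)) j = if J = j then a * b else 0 := by
  rw [PiLp.smul_apply, PiLp.smul_apply, PiLp.single_apply]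
  by_cases h : J = j
  · simp [h]
  · simp [h, Ne.symm h]

/-- The square function in the definition of `sobolevNorm`. -/
def squareFun (d : ℕ) (s : ℝ) (f : (Fin d → ℝ) → ℂ) (x : Fin d → ℝ) : ℝ≥0∞ :=
  (∑' j : Fin d → ℕ, (ENNReal.ofReal ((2:ℝ) ^ (((∑ i, j i : ℕ) : ℝ) * s)) *
    (‖blockProj d f j x‖₊ : ℝ≥0∞)) ^ (2:ℕ)) ^ ((1:ℝ)/2)

/-- The hyperbolic-cross Hardy–Littlewood inequality in terms of the square function. -/
theorem exists_tsum_coeff_le (d : ℕ) {P : ℝ} (hP1 : 1 < P) (hP2 : P ≤ 2) (s : ℝ) :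
    ∃ C : ℝ, 0 ≤ C ∧ ∀ f : (Fin d → ℝ) → ℂ,
      ∑' k : Fin d → ℤ, ENNReal.ofReal ((2 : ℝ) ^ ((tlev k : ℝ) * (P - 2 + s * P))) *
        ‖fCoeff d f k‖ₑ ^ P ≤ ENNReal.ofReal C * ∫⁻ x in cube d, squareFun d s f x ^ P := by
  classical
  obtain ⟨C, hC0, hC⟩ := exists_paley_const hP1 hP2 (K := 6) (by norm_num)
  have hP0 : 0 < P := by linarith
  refine ⟨C ^ d, by positivity, fun f => ?_⟩
  rw [ENNReal.tsum_eq_iSup_sum]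
  refine iSup_le fun S => ?_
  obtain ⟨M, hM⟩ : ∃ M, ∀ k ∈ S, tlev k ≤ M := ⟨S.sup tlev, fun k hk => Finset.le_sup hk⟩
  let F : Finset ℤ := (Finset.range (M + 1)).biUnion blockF
  have hF : ∀ {a : ℤ}, a ∈ F ↔ lev a < M + 1 := fun {a} => by
    simp [F, mem_blockF]
  let lv : F → Fin (M + 1) := fun a => ⟨lev a, hF.1 a.2⟩
  let H := EuclideanSpace ℂ (Fin d → Fin (M + 1))
  let v : (Fin d → F) → H := fun k =>
    ((((2 : ℝ) ^ (((∑ i, lev (k i) : ℕ) : ℝ) * s) : ℝ) : ℂ) * fCoeff d f (fun i => k i)) •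
      EuclideanSpace.single (fun i => lv (k i)) 1
  have hφ := isBddOrthonormal_chr (q := fun a : F => (a : ℤ)) Subtype.val_injective
  have h1 : ∀ u : F → H, ∑ i : F, ENNReal.ofReal (((2 : ℝ) ^ lev i) ^ (P - 2)) * ‖u i‖ₑ ^ P
        ≤ ENNReal.ofReal C * ∫⁻ x, ‖∑ i : F, chr i x • u i‖ₑ ^ P ∂unitMeasure := fun u =>
    hC hφ (ω := fun a : F => (2 : ℝ) ^ lev a) (fun i => by positivity)
      (fun t ht => sum_lev_weight_le Subtype.val_injective ht) u
  have h2 := sum_prod_weight_le (fun a : F => (continuous_chr a).measurable) h1 d v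
  rw [← restrict_cube] at h2
  have hterm : ∀ k : Fin d → F, ENNReal.ofReal
        ((2 : ℝ) ^ ((tlev (fun i => (k i : ℤ)) : ℝ) * (P - 2 + s * P))) *
        ‖fCoeff d f (fun i => k i)‖ₑ ^ P
      = (∏ i, ENNReal.ofReal (((2 : ℝ) ^ lev (k i)) ^ (P - 2))) * ‖v k‖ₑ ^ P := by
    intro k
    have hv : ‖v k‖ₑ = ENNReal.ofReal ((2 : ℝ) ^ ((tlev (fun i => (k i : ℤ)) : ℝ) * s)) *
        ‖fCoeff d f (fun i => k i)‖ₑ := by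
      simp only [v]
      rw [enorm_smul, enorm_mul, ← ofReal_norm, ← ofReal_norm (EuclideanSpace.single _ _)]
      simp only [PiLp.norm_single, norm_one, ENNReal.ofReal_one, mul_one]
      rw [Complex.norm_real, Real.norm_of_nonneg (by positivity)]
      rfl
    rw [hv, ENNReal.mul_rpow_of_nonneg _ _ hP0.le, ← mul_assoc,
      ← ENNReal.ofReal_prod_of_nonneg fun i _ => by positivity,
      ENNReal.ofReal_rpow_of_nonneg (by positivity) hP0.le, ← ENNReal.ofReal_mul (by positivity)]
    congr 2
    rw [Real.finsetProd_rpow _ _ fun i _ => by positivity, Finset.prod_pow_eq_pow_sum,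
      ← Real.rpow_natCast, ← Real.rpow_mul zero_le_two, ← Real.rpow_mul zero_le_two,
      ← Real.rpow_add zero_lt_two]
    congr 1
    simp only [tlev]
    ring
  have hS : ∑ k ∈ S, ENNReal.ofReal ((2 : ℝ) ^ ((tlev k : ℝ) * (P - 2 + s * P))) *
        ‖fCoeff d f k‖ₑ ^ P
      ≤ ∑ k : Fin d → F, ENNReal.ofReal
        ((2 : ℝ) ^ ((tlev (fun i => (k i : ℤ)) : ℝ) * (P - 2 + s * P))) *
        ‖fCoeff d f (fun i => k i)‖ₑ ^ P := by
    have hinj : Function.Injective fun (k : Fin d → F) (i : Fin d) => (k i : ℤ) :=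
      fun a b h => funext fun i => Subtype.ext (congrFun h i)
    rw [← Finset.sum_image (f := fun k : Fin d → ℤ => ENNReal.ofReal
      ((2 : ℝ) ^ ((tlev k : ℝ) * (P - 2 + s * P))) * ‖fCoeff d f k‖ₑ ^ P)
      (g := fun (k : Fin d → F) (i : Fin d) => (k i : ℤ)) hinj.injOn]
    refine Finset.sum_le_sum_of_subset fun k hk => ?_
    refine Finset.mem_image.2 ⟨fun i => ⟨k i, hF.2 ?_⟩, Finset.mem_univ _, rfl⟩
    have : lev (k i) ≤ tlev k := Finset.single_le_sum (f := fun i => lev (k i))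
      (fun _ _ => Nat.zero_le _) (Finset.mem_univ i)
    have := hM k hk
    omega
  refine hS.trans ?_
  simp_rw [hterm]
  refine h2.trans ?_
  rw [ENNReal.ofReal_pow hC0]
  gcongr with x
  rw [enorm_eq_coord_rpow, squareFun]
  gcongr
  have hcoord : ∀ j : Fin d → Fin (M + 1),
      (∑ k : Fin d → F, (∏ i, chr (k i) (x i)) • v k) j
        = (((2 : ℝ) ^ (((∑ i, (j i : ℕ) : ℕ) : ℝ) * s) : ℝ) : ℂ) *
          blockProj d f (fun i => j i) x := by
    intro j
    have e : (∑ k : Fin d → F, (∏ i, chr (k i) (x i)) • v k) j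
        = ∑ k : Fin d → F, if (fun i => lv (k i)) = j then
          (((2 : ℝ) ^ (((∑ i, (j i : ℕ) : ℕ) : ℝ) * s) : ℝ) : ℂ) *
          (fCoeff d f (fun i => k i) * expk d (fun i => k i) x) else 0 := by
      rw [WithLp.ofLp_sum, Finset.sum_apply]
      refine Finset.sum_congr rfl fun k _ => ?_
      refine (smul_single_apply _ _ _ _).trans ?_
      rw [expk_eq_prod]
      split_ifs with h
      · subst h
        simp only [lv]
        ring
      · rfl
    rw [e, blockProj, Finset.mul_sum, ← Finset.sum_filter]
    refine Finset.sum_bij (fun k _ i => (k i : ℤ)) ?_ ?_ ?_ ?_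
    · intro k hk
      refine Fintype.mem_piFinset.2 fun i => mem_blockF.2 ?_
      have := congrFun (Finset.mem_filter.1 hk).2 i
      rw [← this]
    · intro a _ b _ h
      exact funext fun i => Subtype.ext (congrFun h i)
    · intro k hk
      have hk' : ∀ i, lev (k i) = j i := fun i => mem_blockF.1 (Fintype.mem_piFinset.1 hk i)
      refine ⟨fun i => ⟨k i, hF.2 (by rw [hk' i]; exact (j i).2)⟩, ?_, rfl⟩
      refine Finset.mem_filter.2 ⟨Finset.mem_univ _, funext fun i => Fin.ext (hk' i)⟩
    · intro k _; rfl
  have hinj : Function.Injective fun (j : Fin d → Fin (M + 1)) (i : Fin d) => (j i : ℕ) :=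
    fun a b h => funext fun i => Fin.ext (congrFun h i)
  refine le_trans (le_of_eq ?_) (ENNReal.tsum_comp_le_tsum_of_injective hinj _)
  rw [tsum_fintype]
  refine Finset.sum_congr rfl fun j _ => ?_
  rw [hcoord, enorm_mul, ← ofReal_norm (((2 : ℝ) ^ _ : ℝ) : ℂ), Complex.norm_real,
    Real.norm_of_nonneg (by positivity)]
  rfl

/-- The multi-indices in dyadic blocks of total order `l`. -/
def levelSet (d l : ℕ) : Finset (Fin d → ℤ) :=
  (Finset.Nat.antidiagonalTuple d l).biUnion fun j => Fintype.piFinset fun i => blockF (j i)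

theorem mem_levelSet {d l : ℕ} {k : Fin d → ℤ} : k ∈ levelSet d l ↔ tlev k = l := by
  simp only [levelSet, Finset.mem_biUnion, Finset.Nat.mem_antidiagonalTuple,
    Fintype.mem_piFinset, mem_blockF]
  constructor
  · rintro ⟨j, hj, hk⟩
    rw [← hj, tlev]
    exact Finset.sum_congr rfl fun i _ => hk i
  · exact fun h => ⟨fun i => lev (k i), h, fun _ => rfl⟩

theorem card_antidiagonalTuple_succ_le (D l : ℕ) :
    (Finset.Nat.antidiagonalTuple (D + 1) l).card ≤ (l + 1) ^ D := by
  calc _ ≤ (Fintype.piFinset fun _ : Fin D => Finset.range (l + 1)).card := by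
        refine Finset.card_le_card_of_injOn (fun j i => j i.castSucc) (fun j hj => ?_) ?_
        · have hj' := Finset.Nat.mem_antidiagonalTuple.1 hj
          simp only [Finset.mem_coe, Fintype.mem_piFinset, Finset.mem_range]
          intro i
          have := Finset.single_le_sum (f := j) (fun _ _ => Nat.zero_le _)
            (Finset.mem_univ i.castSucc)
          omega
        · intro a ha b hb h
          have ha' := Finset.Nat.mem_antidiagonalTuple.1 ha
          have hb' := Finset.Nat.mem_antidiagonalTuple.1 hb
          rw [Fin.sum_univ_castSucc] at ha' hb'
          have h' : ∀ i : Fin D, a i.castSucc = b i.castSucc := fun i => congrFun h i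
          simp_rw [h'] at ha'
          funext i
          refine Fin.lastCases ?_ (fun i => h' i) i
          omega
    _ = _ := by simp

theorem card_levelSet_le (D l : ℕ) :
    (levelSet (D + 1) l).card ≤ 3 ^ (D + 1) * 2 ^ l * (l + 1) ^ D := by
  refine Finset.card_biUnion_le.trans ?_
  calc _ ≤ ∑ _j ∈ Finset.Nat.antidiagonalTuple (D + 1) l, 3 ^ (D + 1) * 2 ^ l := by
        refine Finset.sum_le_sum fun j hj => ?_
        rw [Fintype.card_piFinset]
        refine (Finset.prod_le_prod' fun i _ => card_blockF_le (j i)).trans ?_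
        rw [Finset.prod_mul_distrib, Finset.prod_const, Finset.prod_pow_eq_pow_sum,
          Finset.Nat.mem_antidiagonalTuple.1 hj]
        simp
    _ ≤ _ := by
        rw [Finset.sum_const, smul_eq_mul, mul_comm]
        exact Nat.mul_le_mul_left _ (card_antidiagonalTuple_succ_le D l)

theorem tsum_eq_tsum_levelSet {d : ℕ} (g : (Fin d → ℤ) → ℝ≥0∞) :
    ∑' k, g k = ∑' l, ∑ k ∈ levelSet d l, g k := by
  rw [← (Equiv.sigmaFiberEquiv (tlev (d := d))).tsum_eq, ENNReal.tsum_sigma']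
  refine tsum_congr fun l => ?_
  have := Finset.tsum_subtype (levelSet d l) g
  rw [← this]
  exact (Equiv.subtypeEquivRight fun k => (mem_levelSet (l := l)).symm).tsum_eq
    fun k : levelSet d l => g k

theorem exists_tsum_tail_le {κ δ : ℝ} (hκ : 0 ≤ κ) (hδ : 0 < δ) : ∃ C : ℝ, 0 ≤ C ∧ ∀ n : ℕ,
    ∑' l : ℕ, (if n < l then ENNReal.ofReal (((l : ℝ) + 1) ^ κ * (2 : ℝ) ^ (-(l * δ))) else 0)
      ≤ ENNReal.ofReal (C * (((n : ℝ) + 1) ^ κ * (2 : ℝ) ^ (-(n * δ)))) := by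
  have hq1 : (2 : ℝ) ^ (-δ) < 1 := Real.rpow_lt_one_of_one_lt_of_neg one_lt_two (by linarith)
  have hq0 : 0 < (2 : ℝ) ^ (-δ) := by positivity
  have hqi : ∀ i : ℕ, (2 : ℝ) ^ (-(i * δ)) = ((2 : ℝ) ^ (-δ)) ^ i := fun i => by
    rw [← Real.rpow_natCast, ← Real.rpow_mul zero_le_two]; congr 1; ring
  have hs : Summable fun i : ℕ => ((i : ℝ) + 2) ^ κ * (2 : ℝ) ^ (-(i * δ)) := by
    have h1 := (summable_nat_add_iff 2).2 (summable_pow_mul_geometric_of_norm_lt_one ⌈κ⌉₊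
      (r := (2 : ℝ) ^ (-δ)) (by rwa [Real.norm_of_nonneg hq0.le]))
    have h2 := h1.mul_left (((2 : ℝ) ^ (-δ)) ^ 2)⁻¹
    refine Summable.of_nonneg_of_le (fun i => by positivity) (fun i => ?_) h2
    rw [hqi]
    push_cast
    rw [pow_add]
    have h3 : ((i : ℝ) + 2) ^ κ ≤ ((i : ℝ) + 2) ^ ⌈κ⌉₊ := by
      rw [← Real.rpow_natCast]
      exact Real.rpow_le_rpow_of_exponent_le (by linarith [(Nat.cast_nonneg i : (0 : ℝ) ≤ i)])
        (Nat.le_ceil κ)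
    calc _ ≤ ((i : ℝ) + 2) ^ ⌈κ⌉₊ * ((2 : ℝ) ^ (-δ)) ^ i := by gcongr
      _ = _ := by field_simp
  refine ⟨∑' i : ℕ, ((i : ℝ) + 2) ^ κ * (2 : ℝ) ^ (-(i * δ)),
    tsum_nonneg fun i => by positivity, fun n => ?_⟩
  rw [ENNReal.ofReal_mul (tsum_nonneg fun i => by positivity),
    ENNReal.ofReal_tsum_of_nonneg (fun i => by positivity) hs, ← ENNReal.tsum_mul_right]
  refine (ENNReal.summable.sum_add_tsum_nat_add' (k := n + 1)
    (f := fun l : ℕ => if n < l then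
      ENNReal.ofReal (((l : ℝ) + 1) ^ κ * (2 : ℝ) ^ (-(l * δ))) else 0)).symm.le.trans ?_
  rw [Finset.sum_eq_zero, zero_add]
  · refine ENNReal.tsum_le_tsum fun i => ?_
    rw [if_pos (by omega), ← ENNReal.ofReal_mul (by positivity)]
    refine ENNReal.ofReal_le_ofReal ?_
    push_cast
    have hi : (0 : ℝ) ≤ i := Nat.cast_nonneg i
    have hn : (0 : ℝ) ≤ n := Nat.cast_nonneg n
    calc ((i : ℝ) + (n + 1) + 1) ^ κ * (2 : ℝ) ^ (-((i + (n + 1)) * δ))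
        ≤ (((i : ℝ) + 2) * (n + 1)) ^ κ * (2 : ℝ) ^ (-(i * δ) + -(n * δ)) := by
          gcongr
          · nlinarith
          · norm_num
          · nlinarith
      _ = _ := by
          rw [Real.mul_rpow (by positivity) (by positivity), Real.rpow_add zero_lt_two]; ring
  · intro l hl
    rw [if_neg]
    have := Finset.mem_range.1 hl
    omega

/-- Tail estimate for the Fourier coefficients outside a hyperbolic cross. -/
theorem exists_tsum_coeff_tail_le (D : ℕ) {P E r : ℝ} (hP0 : 0 < P) (hE0 : 0 < E) (hEP : E ≤ P)
    (hr : 1 / P + 1 / E - 1 < r) (B : ℝ) (hB : 0 ≤ B) :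
    ∃ C : ℝ, 0 ≤ C ∧ ∀ c : (Fin (D + 1) → ℤ) → ℝ≥0∞,
      ∑' k, ENNReal.ofReal ((2 : ℝ) ^ ((tlev k : ℝ) * (P - 2 + r * P))) * c k ^ P
        ≤ ENNReal.ofReal B → ∀ n : ℕ,
      (∑' k, if n < tlev k then c k ^ E else 0) ^ (1 / E) ≤ ENNReal.ofReal
        (C * (((n : ℝ) + 1) ^ (D * (1 / E - 1 / P)) *
          (2 : ℝ) ^ (-(n * (r + 1 - 1 / P - 1 / E))))) := by
  have hκ : 0 ≤ D * (1 - E / P) := by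
    have : E / P ≤ 1 := (div_le_one hP0).2 hEP
    have : (0 : ℝ) ≤ 1 - E / P := by linarith
    positivity
  have hδ : 0 < E * (r + 1 - 1 / P - 1 / E) := mul_pos hE0 (by linarith)
  obtain ⟨C, hC0, hC⟩ := exists_tsum_tail_le hκ hδ
  have hPE : 1 ≤ P / E := (one_le_div hE0).2 hEP
  set A : ℝ := ((3 : ℝ) ^ (D + 1)) ^ (1 - E / P) * B ^ (E / P) with hA
  have hA0 : 0 ≤ A := by positivity
  refine ⟨(A * C) ^ (1 / E), by positivity, fun c hc n => ?_⟩
  have hlev : ∀ l, ∑ k ∈ levelSet (D + 1) l, c k ^ E ≤ ENNReal.ofReal A * ENNReal.ofReal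
      (((l : ℝ) + 1) ^ (D * (1 - E / P)) * (2 : ℝ) ^ (-(l * (E * (r + 1 - 1 / P - 1 / E))))) := by
    intro l
    have h1 : ∑ k ∈ levelSet (D + 1) l, c k ^ P
        ≤ ENNReal.ofReal ((2 : ℝ) ^ (-((l : ℝ) * (P - 2 + r * P))) * B) := by
      have h2 : ENNReal.ofReal ((2 : ℝ) ^ ((l : ℝ) * (P - 2 + r * P))) *
          ∑ k ∈ levelSet (D + 1) l, c k ^ P ≤ ENNReal.ofReal B := by
        refine le_trans ?_ ((ENNReal.sum_le_tsum (levelSet (D + 1) l)).trans hc)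
        rw [Finset.mul_sum]
        refine Finset.sum_le_sum fun k hk => ?_
        rw [mem_levelSet.1 hk]
      calc _ = ENNReal.ofReal ((2 : ℝ) ^ (-((l : ℝ) * (P - 2 + r * P)))) *
            (ENNReal.ofReal ((2 : ℝ) ^ ((l : ℝ) * (P - 2 + r * P))) *
            ∑ k ∈ levelSet (D + 1) l, c k ^ P) := by
              rw [← mul_assoc, ← ENNReal.ofReal_mul (by positivity),
                ← Real.rpow_add zero_lt_two, neg_add_cancel, Real.rpow_zero,
                ENNReal.ofReal_one, one_mul]
        _ ≤ _ := by
              rw [ENNReal.ofReal_mul (by positivity)]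
              gcongr
    have h3 := ENNReal.rpow_sum_le_const_mul_sum_rpow (levelSet (D + 1) l)
      (fun k => c k ^ E) hPE
    simp_rw [← ENNReal.rpow_mul, mul_div_cancel₀ _ hE0.ne'] at h3
    have hcard : ((levelSet (D + 1) l).card : ℝ≥0∞)
        ≤ ENNReal.ofReal (3 ^ (D + 1) * 2 ^ l * ((l : ℝ) + 1) ^ D) := by
      rw [← ENNReal.ofReal_natCast]
      refine ENNReal.ofReal_le_ofReal ?_
      exact_mod_cast card_levelSet_le D l
    have h4 : (∑ k ∈ levelSet (D + 1) l, c k ^ E) ^ (P / E) ≤ ENNReal.ofReal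
        ((3 ^ (D + 1) * 2 ^ l * ((l : ℝ) + 1) ^ D) ^ (P / E - 1) *
          ((2 : ℝ) ^ (-((l : ℝ) * (P - 2 + r * P))) * B)) := by
      refine h3.trans ?_
      rw [ENNReal.ofReal_mul (by positivity),
        ← ENNReal.ofReal_rpow_of_nonneg (by positivity) (by linarith)]
      gcongr
    have h5 := ENNReal.rpow_le_rpow h4 (z := E / P) (by positivity)
    rw [← ENNReal.rpow_mul, div_mul_div_cancel₀ hE0.ne', div_self hP0.ne', ENNReal.rpow_one,
      ENNReal.ofReal_rpow_of_nonneg (by positivity) (by positivity)] at h5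
    refine h5.trans (le_of_eq ?_)
    rw [← ENNReal.ofReal_mul hA0]
    congr 1
    have e1 : (P / E - 1) * (E / P) = 1 - E / P := by field_simp
    rw [Real.mul_rpow (by positivity) (by positivity), ← Real.rpow_mul (by positivity), e1,
      Real.mul_rpow (by positivity) hB, Real.mul_rpow (by positivity) (by positivity),
      Real.mul_rpow (by positivity) (by positivity), ← Real.rpow_mul zero_le_two,
      ← Real.rpow_natCast 2 l, ← Real.rpow_mul zero_le_two,
      ← Real.rpow_natCast ((l : ℝ) + 1) D, ← Real.rpow_mul (by positivity)]
    have e2 : (2 : ℝ) ^ (-(l * (E * (r + 1 - 1 / P - 1 / E)))) = (2 : ℝ) ^ (l * (1 - E / P)) *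
        (2 : ℝ) ^ (-((l : ℝ) * (P - 2 + r * P)) * (E / P)) := by
      rw [← Real.rpow_add zero_lt_two]
      congr 1
      field_simp
      ring
    rw [e2, hA]
    ring
  have hsum : (∑' k, if n < tlev k then c k ^ E else 0) ≤ ENNReal.ofReal A * ENNReal.ofReal
      (C * (((n : ℝ) + 1) ^ (D * (1 - E / P)) *
        (2 : ℝ) ^ (-(n * (E * (r + 1 - 1 / P - 1 / E)))))) := by
    rw [tsum_eq_tsum_levelSet]
    refine le_trans (ENNReal.tsum_le_tsum fun l => ?_)
      ((ENNReal.tsum_mul_left).le.trans (mul_le_mul_right (hC n) _))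
    split_ifs with h
    · refine le_trans (Finset.sum_le_sum fun k _ => ?_) (hlev l)
      split_ifs <;> simp
    · refine (Finset.sum_eq_zero fun k hk => ?_).le.trans zero_le
      rw [if_neg (by rwa [mem_levelSet.1 hk])]
  refine (ENNReal.rpow_le_rpow hsum (by positivity)).trans (le_of_eq ?_)
  rw [← ENNReal.ofReal_mul hA0, ENNReal.ofReal_rpow_of_nonneg (by positivity) (by positivity)]
  congr 1
  rw [← mul_assoc, Real.mul_rpow (by positivity) (by positivity)]
  congr 1
  rw [Real.mul_rpow (by positivity) (by positivity), ← Real.rpow_mul (by positivity),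
    ← Real.rpow_mul zero_le_two]
  congr 2
  · field_simp
  · field_simp

theorem card_biUnion_levelSet_le (D n : ℕ) :
    ((Finset.range (n + 1)).biUnion (levelSet (D + 1))).card
      ≤ 3 ^ (D + 1) * 2 ^ (n + 1) * (n + 1) ^ D := by
  refine Finset.card_biUnion_le.trans ?_
  calc _ ≤ ∑ l ∈ Finset.range (n + 1), 2 ^ l * (3 ^ (D + 1) * (n + 1) ^ D) := by
        refine Finset.sum_le_sum fun l hl => (card_levelSet_le D l).trans ?_
        have : l + 1 ≤ n + 1 := by have := Finset.mem_range.1 hl; omega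
        calc _ ≤ 3 ^ (D + 1) * 2 ^ l * (n + 1) ^ D := by gcongr
          _ = _ := by ring
    _ = (∑ l ∈ Finset.range (n + 1), 2 ^ l) * (3 ^ (D + 1) * (n + 1) ^ D) := by
        rw [Finset.sum_mul]
    _ ≤ 2 ^ (n + 1) * (3 ^ (D + 1) * (n + 1) ^ D) := by
        refine Nat.mul_le_mul_right _ ?_
        rw [Nat.geomSum_eq le_rfl]
        simp
    _ = _ := by ring

theorem wienerNorm_zero_eq {d : ℕ} {η : ℝ≥0∞} (hη : η ≠ ∞) (f : (Fin d → ℝ) → ℂ) :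
    wienerNorm d 0 η f = (∑' k, ‖fCoeff d f k‖ₑ ^ η.toReal) ^ (1 / η.toReal) := by
  simp only [wienerNorm, if_neg hη, Real.rpow_zero, ENNReal.ofReal_one, one_mul]
  rfl

theorem sobolevNorm_eq {d : ℕ} {s : ℝ} (hs : s ≠ 0) (p : ℝ≥0∞) (f : (Fin d → ℝ) → ℂ) :
    sobolevNorm d s p f = (∫⁻ x in cube d, squareFun d s f x ^ p.toReal) ^ (1 / p.toReal) := by
  rw [sobolevNorm, if_neg hs]
  rfl

/-- Approximation by hyperbolic-cross partial sums. -/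
theorem exists_sigmaClass_le (D : ℕ) {p η : ℝ≥0∞} {r : ℝ} (hp1 : 1 < p) (hp2 : p ≤ 2)
    (hη0 : 0 < η) (hηp : η ≤ p) (hr : 1 / p.toReal + 1 / η.toReal - 1 < r) (hr0 : r ≠ 0) :
    ∃ C : ℝ, 0 ≤ C ∧ ∀ m n : ℕ, 3 ^ (D + 1) * 2 ^ (n + 1) * (n + 1) ^ D ≤ m →
      sigmaClass (D + 1) m (sobolevNorm (D + 1) r p) (wienerNorm (D + 1) 0 η)
        ≤ ENNReal.ofReal (C * (((n : ℝ) + 1) ^ (D * (1 / η.toReal - 1 / p.toReal)) *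
          (2 : ℝ) ^ (-(n * (r + 1 - 1 / p.toReal - 1 / η.toReal))))) := by
  have hpt : p ≠ ∞ := (hp2.trans_lt (by simp)).ne
  have hηt : η ≠ ∞ := (hηp.trans_lt hpt.lt_top).ne
  have hP1 : 1 < p.toReal := by
    simpa using (ENNReal.toReal_lt_toReal (by simp) hpt).2 hp1
  have hP2 : p.toReal ≤ 2 := by
    simpa using (ENNReal.toReal_le_toReal hpt (by simp)).2 hp2
  have hE0 : 0 < η.toReal := ENNReal.toReal_pos hη0.ne' hηt
  have hEP : η.toReal ≤ p.toReal := (ENNReal.toReal_le_toReal hηt hpt).2 hηp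
  obtain ⟨B, hB0, hB⟩ := exists_tsum_coeff_le (D + 1) hP1 hP2 r
  obtain ⟨C, hC0, hC⟩ := exists_tsum_coeff_tail_le D (by linarith) hE0 hEP hr B hB0
  refine ⟨C, hC0, fun m n hmn => iSup₂_le fun f hf => ?_⟩
  obtain ⟨hfi, hfn⟩ := hf
  set Λ := (Finset.range (n + 1)).biUnion (levelSet (D + 1)) with hΛ
  have hmem : ∀ k, k ∈ Λ ↔ tlev k ≤ n := fun k => by
    simp [hΛ, mem_levelSet]
  refine iInf₂_le_of_le (fun x => ∑ k ∈ Λ, fCoeff (D + 1) f k * expk (D + 1) k x)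
    ⟨Λ, _, (card_biUnion_levelSet_le D n).trans hmn, rfl⟩ ?_
  rw [wienerNorm_zero_eq hηt]
  refine le_trans (le_of_eq ?_) (hC (fun k => ‖fCoeff (D + 1) f k‖ₑ) ?_ n)
  · congr 1
    refine tsum_congr fun k => ?_
    rw [fCoeff_sub hfi (integrableOn_trigPoly _ _ _), fCoeff_trigPoly]
    by_cases h : tlev k ≤ n
    · rw [if_pos ((hmem k).2 h), if_neg (by omega), sub_self, enorm_zero,
        ENNReal.zero_rpow_of_pos hE0]
    · rw [if_neg (fun h' => h ((hmem k).1 h')), if_pos (by omega), sub_zero]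
  · refine (hB f).trans ?_
    rw [sobolevNorm_eq hr0] at hfn
    have : ∫⁻ x in cube (D + 1), squareFun (D + 1) r f x ^ p.toReal ≤ 1 := by
      have := ENNReal.rpow_le_rpow hfn (z := p.toReal) (by linarith)
      rwa [← ENNReal.rpow_mul, one_div_mul_cancel (by linarith), ENNReal.rpow_one,
        ENNReal.one_rpow] at this
    calc _ ≤ ENNReal.ofReal B * 1 := by gcongr
      _ = _ := mul_one _

theorem one_le_logStar (m : ℕ) : 1 ≤ logStar m := le_max_right _ _

theorem exists_dyadic_scale (D : ℕ) {A : ℝ} (hA : 0 < A) : ∃ m₀ : ℕ, ∀ m : ℕ, m₀ ≤ m →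
    1 ≤ m ∧ ∃ n : ℕ, logStar m ≤ 2 * n ∧ n ≤ 2 * logStar m ∧
      (2 : ℝ) ^ n ≤ A * m / logStar m ^ D ∧ A * m / logStar m ^ D < 2 * 2 ^ n := by
  have hl2 : 0 < Real.log 2 := Real.log_pos one_lt_two
  have h1 := (isLittleO_log_rpow_rpow_atTop (D : ℝ) (by norm_num : (0 : ℝ) < 1 / 2)).bound
    (show 0 < A / 2 * Real.log 2 ^ D by positivity)
  have h2 := (h1.and ((Filter.eventually_ge_atTop A).and (Filter.eventually_ge_atTop 2)))
  obtain ⟨m₀, hm₀⟩ := Filter.eventually_atTop.1 (tendsto_natCast_atTop_atTop.eventually h2)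
  refine ⟨m₀, fun m hm => ?_⟩
  obtain ⟨hlog, hAm, hm2⟩ := hm₀ m hm
  have hm0 : (0 : ℝ) < m := by linarith
  have hL : logStar m = Real.logb 2 m := max_eq_left <| by
    rw [← Real.logb_self_eq_one one_lt_two]
    exact Real.logb_le_logb_of_le one_lt_two two_pos hm2
  have hL1 := one_le_logStar m
  set L := logStar m with hLdef
  have h2L : (2 : ℝ) ^ L = m := by rw [hL]; exact Real.rpow_logb two_pos (by norm_num) hm0
  have hLD : L ^ D ≤ A / 2 * (m : ℝ) ^ ((1 : ℝ) / 2) := by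
    have hl0 : 0 ≤ Real.log m := Real.log_nonneg (by linarith)
    rw [Real.norm_of_nonneg (by positivity), Real.norm_of_nonneg (by positivity),
      Real.rpow_natCast] at hlog
    rw [hL, Real.logb, div_pow, div_le_iff₀ (by positivity)]
    linarith
  have hLD1 : 1 ≤ L ^ D := one_le_pow₀ hL1
  have hsq : (m : ℝ) ^ ((1 : ℝ) / 2) * (m : ℝ) ^ ((1 : ℝ) / 2) = m := by
    rw [← Real.rpow_add hm0]; norm_num
  have hm1 : 1 ≤ (m : ℝ) ^ ((1 : ℝ) / 2) := Real.one_le_rpow (by linarith) (by norm_num)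
  have hlow : 2 * (m : ℝ) ^ ((1 : ℝ) / 2) ≤ A * m / L ^ D := by
    rw [le_div_iff₀ (by positivity)]
    calc _ ≤ 2 * (m : ℝ) ^ ((1 : ℝ) / 2) * (A / 2 * (m : ℝ) ^ ((1 : ℝ) / 2)) := by gcongr
      _ = A * ((m : ℝ) ^ ((1 : ℝ) / 2) * (m : ℝ) ^ ((1 : ℝ) / 2)) := by ring
      _ = _ := by rw [hsq]
  obtain ⟨n, hn1, hn2⟩ := exists_nat_pow_near (by linarith : 1 ≤ A * m / L ^ D) one_lt_two
  refine ⟨by exact_mod_cast (by linarith : (1 : ℝ) ≤ m), n, ?_, ?_, hn1, by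
    rw [pow_succ] at hn2; linarith⟩
  · have h3 : (2 : ℝ) ^ (L / 2) < 2 ^ (n : ℝ) := by
      have e : (2 : ℝ) ^ (L / 2) = (m : ℝ) ^ ((1 : ℝ) / 2) := by
        rw [← h2L, ← Real.rpow_mul zero_le_two]; congr 1; ring
      rw [e, Real.rpow_natCast]
      rw [pow_succ] at hn2
      linarith
    have := (Real.rpow_lt_rpow_left_iff one_lt_two).1 h3
    linarith
  · have h3 : (2 : ℝ) ^ (n : ℝ) ≤ 2 ^ (2 * L) := by
      rw [two_mul, Real.rpow_add two_pos, h2L, Real.rpow_natCast]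
      calc _ ≤ A * m / L ^ D := hn1
        _ ≤ A * m := div_le_self (by positivity) hLD1
        _ ≤ _ := by gcongr
    exact (Real.rpow_le_rpow_left_iff one_lt_two).1 h3

/-- The upper bound for the `m`-term widths. -/
theorem exists_sigmaClass_upper (D : ℕ) {p η : ℝ≥0∞} {r : ℝ} (hp1 : 1 < p) (hp2 : p ≤ 2)
    (hη0 : 0 < η) (hηp : η ≤ p) (hr : 1 / p.toReal + 1 / η.toReal - 1 < r) (hr0 : r ≠ 0)
    (hηP : 1 / p.toReal ≤ 1 / η.toReal) :
    ∃ C : ℝ, 0 < C ∧ ∃ m₀ : ℕ, ∀ m : ℕ, m₀ ≤ m →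
      sigmaClass (D + 1) m (sobolevNorm (D + 1) r p) (wienerNorm (D + 1) 0 η)
        ≤ ENNReal.ofReal (C * ((m : ℝ) ^ (-(r + 1 - 1 / p.toReal - 1 / η.toReal)) *
          logStar m ^ (D * (r + 1 - 2 / p.toReal)))) := by
  obtain ⟨C, hC0, hC⟩ := exists_sigmaClass_le D hp1 hp2 hη0 hηp hr hr0
  set β := r + 1 - 1 / p.toReal - 1 / η.toReal with hβ
  set κ := D * (1 / η.toReal - 1 / p.toReal) with hκ
  have hβ0 : 0 < β := by linarith
  have hκ0 : 0 ≤ κ := mul_nonneg (Nat.cast_nonneg D) (by linarith)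
  set A : ℝ := (3 ^ (D + 1) * 2 * 3 ^ D)⁻¹ with hA
  have hA0 : 0 < A := by positivity
  obtain ⟨m₀, hm₀⟩ := exists_dyadic_scale D hA0
  refine ⟨(C + 1) * (3 ^ κ * (A / 2) ^ (-β)), by positivity, m₀, fun m hm => ?_⟩
  obtain ⟨hm1, n, -, hn2, hn3, hn4⟩ := hm₀ m hm
  have hL1 := one_le_logStar m
  set L := logStar m with hL
  have hm0 : (0 : ℝ) < m := by exact_mod_cast hm1
  have hn5 : (n : ℝ) + 1 ≤ 3 * L := by linarith
  refine (hC m n ?_).trans (ENNReal.ofReal_le_ofReal ?_)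
  · have : ((3 ^ (D + 1) * 2 ^ (n + 1) * (n + 1) ^ D : ℕ) : ℝ) ≤ m := by
      push_cast
      calc (3 : ℝ) ^ (D + 1) * 2 ^ (n + 1) * (n + 1) ^ D
          = 3 ^ (D + 1) * 2 * 2 ^ n * (n + 1) ^ D := by ring
        _ ≤ 3 ^ (D + 1) * 2 * (A * m / L ^ D) * (3 * L) ^ D := by gcongr
        _ = m := by rw [hA, mul_pow]; field_simp
    exact_mod_cast this
  · have h1 : (2 : ℝ) ^ (-(n * β)) ≤ (A / 2) ^ (-β) * ((m : ℝ) ^ (-β) * L ^ (D * β)) := by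
      calc (2 : ℝ) ^ (-(n * β)) = ((2 : ℝ) ^ n) ^ (-β) := by
            rw [← Real.rpow_natCast, ← Real.rpow_mul zero_le_two]; congr 1; ring
        _ ≤ (A / 2 * (m * (L ^ D)⁻¹)) ^ (-β) := by
            refine Real.rpow_le_rpow_of_nonpos (by positivity) ?_ (by linarith)
            rw [div_eq_mul_inv] at hn4
            linarith
        _ = _ := by
            rw [Real.mul_rpow (by positivity) (by positivity),
              Real.mul_rpow (by positivity) (by positivity), Real.inv_rpow (by positivity),
              ← Real.rpow_neg (by positivity), neg_neg, ← Real.rpow_natCast L,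
              ← Real.rpow_mul (by positivity)]
    have h2 : ((n : ℝ) + 1) ^ κ ≤ 3 ^ κ * L ^ κ := by
      rw [← Real.mul_rpow (by norm_num) (by positivity)]
      gcongr
    have e : L ^ (D * (r + 1 - 2 / p.toReal)) = L ^ κ * L ^ (D * β) := by
      rw [← Real.rpow_add (by positivity)]
      congr 1
      rw [hκ, hβ]
      ring
    calc C * (((n : ℝ) + 1) ^ κ * (2 : ℝ) ^ (-(n * β)))
        ≤ (C + 1) * ((3 ^ κ * L ^ κ) * ((A / 2) ^ (-β) * ((m : ℝ) ^ (-β) * L ^ (D * β)))) := by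
          gcongr
          linarith
      _ = _ := by rw [e]; ring

theorem lev_eq_of_le_of_lt {k : ℤ} {n : ℕ} (h1 : 2 ^ n ≤ k) (h2 : k < 2 ^ (n + 1)) :
    lev k = n + 1 := by
  have h0 : (0 : ℤ) ≤ k := le_trans (by positivity) h1
  refine mem_blockF.1 ?_
  rw [blockF, Finset.mem_filter, Finset.mem_Icc]
  refine ⟨⟨by have : (0 : ℤ) < 2 ^ (n + 1) := by positivity
              linarith, h2.le⟩, Or.inr ⟨by omega, ?_, ?_⟩⟩
  · rwa [abs_of_nonneg h0, Nat.add_sub_cancel]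
  · rwa [abs_of_nonneg h0]

/-- The coefficients of the modulated Fejér kernel supported in the dyadic block of order
`n + 2`. -/
def bumpCoeff (n : ℕ) (k : ℤ) : ℝ :=
  ((Finset.univ.filter fun z : Fin (2 ^ n) × Fin (2 ^ n) =>
    (2 : ℤ) ^ (n + 1) + z.1 + z.2 = k).card : ℝ) / 2 ^ n

/-- The modulated Fejér kernel with frequencies in the dyadic block of order `n + 2`. -/
def bump (n : ℕ) (x : ℝ) : ℂ := ∑ k ∈ blockF (n + 2), (bumpCoeff n k : ℂ) * chr k x

theorem continuous_bump (n : ℕ) : Continuous (bump n) :=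
  continuous_finsetSum _ fun _ _ => continuous_const.mul (continuous_chr _)

theorem lev_freq {n : ℕ} (u v : Fin (2 ^ n)) : lev ((2 : ℤ) ^ (n + 1) + u + v) = n + 2 := by
  have hu : ((u : ℕ) : ℤ) < 2 ^ n := by exact_mod_cast u.2
  have hv : ((v : ℕ) : ℤ) < 2 ^ n := by exact_mod_cast v.2
  have e1 : (2 : ℤ) ^ (n + 1) = 2 * 2 ^ n := by ring
  have e2 : (2 : ℤ) ^ (n + 1 + 1) = 4 * 2 ^ n := by ring
  exact lev_eq_of_le_of_lt (by omega) (by omega)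

theorem bump_eq (n : ℕ) (x : ℝ) :
    bump n x = (2 ^ n : ℂ)⁻¹ * (chr (2 ^ (n + 1)) x * (∑ u : Fin (2 ^ n), chr u x) ^ 2) := by
  rw [sq, Finset.sum_mul_sum, ← Fintype.sum_prod_type', Finset.mul_sum]
  have h1 : ∀ z : Fin (2 ^ n) × Fin (2 ^ n), chr (2 ^ (n + 1)) x * (chr z.1 x * chr z.2 x)
      = chr ((2 : ℤ) ^ (n + 1) + z.1 + z.2) x := fun z => by
    rw [chr_add, chr_add, mul_assoc]
  simp_rw [h1]
  rw [← Finset.sum_fiberwise_of_maps_to (t := blockF (n + 2))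
    (g := fun z : Fin (2 ^ n) × Fin (2 ^ n) => (2 : ℤ) ^ (n + 1) + z.1 + z.2)
    fun z _ => mem_blockF.2 (lev_freq _ _), Finset.mul_sum, bump]
  refine Finset.sum_congr rfl fun k _ => ?_
  rw [Finset.sum_congr rfl (g := fun _ => chr k x) fun z hz => by
    rw [(Finset.mem_filter.1 hz).2], Finset.sum_const, nsmul_eq_mul, bumpCoeff]
  push_cast
  ring

theorem norm_bump (n : ℕ) (x : ℝ) :
    ‖bump n x‖ = ((2 : ℝ) ^ n)⁻¹ * ‖∑ u : Fin (2 ^ n), chr u x‖ ^ 2 := by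
  rw [bump_eq, norm_mul, norm_mul, norm_chr, norm_inv, norm_pow, norm_pow, Complex.norm_ofNat,
    one_mul]

theorem norm_bump_le (n : ℕ) (x : ℝ) : ‖bump n x‖ ≤ 2 ^ n := by
  have h : ‖∑ u : Fin (2 ^ n), chr u x‖ ≤ 2 ^ n := by
    refine (norm_sum_le _ _).trans (le_of_eq ?_)
    simp [norm_chr]
  rw [norm_bump]
  calc _ ≤ ((2 : ℝ) ^ n)⁻¹ * (2 ^ n) ^ 2 := by gcongr
    _ = _ := by field_simp

theorem integral_norm_bump (n : ℕ) : ∫ x, ‖bump n x‖ ∂unitMeasure = 1 := by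
  have hφ := isBddOrthonormal_chr (q := fun u : Fin (2 ^ n) => ((u : ℕ) : ℤ))
    fun u v h => Fin.ext (Int.ofNat.inj h)
  have h := hφ.integral_norm_sq fun _ => (1 : ℂ)
  simp only [smul_eq_mul, mul_one] at h
  simp_rw [norm_bump]
  rw [integral_const_mul, h]
  simp

theorem lintegral_bump_le (n : ℕ) {P : ℝ} (hP : 1 ≤ P) :
    ∫⁻ x, ‖bump n x‖ₑ ^ P ∂unitMeasure ≤ ENNReal.ofReal (((2 : ℝ) ^ n) ^ (P - 1)) := by
  have hint : Integrable (fun x => ‖bump n x‖) unitMeasure :=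
    (integrable_of_norm_le (continuous_bump n).aestronglyMeasurable (norm_bump_le n)).norm
  have h1 : ∫⁻ x, ‖bump n x‖ₑ ∂unitMeasure = 1 := by
    have := ofReal_integral_eq_lintegral_ofReal hint
      (Filter.Eventually.of_forall fun x => norm_nonneg _)
    rw [integral_norm_bump, ENNReal.ofReal_one] at this
    rw [this]
    simp_rw [ofReal_norm]
  calc _ ≤ ∫⁻ x, ENNReal.ofReal (((2 : ℝ) ^ n) ^ (P - 1)) * ‖bump n x‖ₑ ∂unitMeasure := by
        refine lintegral_mono fun x => ?_
        rw [← ofReal_norm, ENNReal.ofReal_rpow_of_nonneg (norm_nonneg _) (by linarith),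
          ← ENNReal.ofReal_mul (by positivity)]
        refine ENNReal.ofReal_le_ofReal ?_
        have e : P = (P - 1) + 1 := by ring
        calc ‖bump n x‖ ^ P = ‖bump n x‖ ^ (P - 1) * ‖bump n x‖ := by
              conv_lhs => rw [e]
              rw [Real.rpow_add_one' (norm_nonneg _) (by linarith)]
          _ ≤ _ := by
              gcongr
              exact norm_bump_le n x
    _ = _ := by
        rw [lintegral_const_mul' _ _ ENNReal.ofReal_ne_top, h1, mul_one]

theorem le_card_bumpCoeff (n : ℕ) :
    2 ^ n ≤ 2 * ((blockF (n + 2)).filter fun k => 1 / 2 ≤ bumpCoeff n k).card := by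
  have key : (Finset.Ico (2 ^ n / 2) (2 ^ n)).card
      ≤ ((blockF (n + 2)).filter fun k => 1 / 2 ≤ bumpCoeff n k).card := by
    refine Finset.card_le_card_of_injOn (fun l : ℕ => (2 : ℤ) ^ (n + 1) + l) (fun l hl => ?_)
      fun a _ b _ h => by simpa using h
    obtain ⟨hl1, hl2⟩ := Finset.mem_Ico.1 (Finset.mem_coe.1 hl)
    have h0 : 0 < 2 ^ n := by positivity
    refine Finset.mem_filter.2 ⟨mem_blockF.2 ?_, ?_⟩
    · simpa using lev_freq (⟨l, hl2⟩ : Fin (2 ^ n)) ⟨0, h0⟩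
    · have h1 : l + 1 ≤ (Finset.univ.filter fun z : Fin (2 ^ n) × Fin (2 ^ n) =>
          (2 : ℤ) ^ (n + 1) + z.1 + z.2 = 2 ^ (n + 1) + l).card := by
        rw [← Fintype.card_fin (l + 1), ← Finset.card_univ]
        refine Finset.card_le_card_of_injOn (fun u : Fin (l + 1) =>
          ((⟨u, by omega⟩ : Fin (2 ^ n)), (⟨l - u, by omega⟩ : Fin (2 ^ n)))) (fun u _ => ?_) ?_
        · simp only [Finset.coe_filter, Finset.mem_univ, true_and, Set.mem_ofPred_eq]
          omega
        · intro u _ v _ h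
          have := congrArg (fun z : Fin (2 ^ n) × Fin (2 ^ n) => (z.1 : ℕ)) h
          exact Fin.ext this
      rw [bumpCoeff, div_le_div_iff₀ two_pos (by positivity)]
      have h2 : ((2 ^ n : ℕ) : ℝ) ≤ (((l + 1) * 2 : ℕ) : ℝ) := by
        exact_mod_cast (by omega)
      have h3 : (((l + 1) * 2 : ℕ) : ℝ) ≤ (((Finset.univ.filter
          fun z : Fin (2 ^ n) × Fin (2 ^ n) =>
          (2 : ℤ) ^ (n + 1) + z.1 + z.2 = 2 ^ (n + 1) + l).card * 2 : ℕ) : ℝ) := by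
        exact_mod_cast Nat.mul_le_mul_right 2 h1
      push_cast at h2 h3 ⊢
      linarith
  rw [Nat.card_Ico] at key
  omega

/-- Lower bound for the number of compositions of `n` with all parts at least two. -/
theorem le_card_antidiagonalTuple (D n : ℕ) (hn : 4 * (D + 1) ≤ n) :
    n ^ D ≤ (4 * (D + 1)) ^ D *
      ((Finset.Nat.antidiagonalTuple (D + 1) n).filter fun j => ∀ i, 2 ≤ j i).card := by
  set q := n / (2 * (D + 1)) with hq
  have hq2 : q * (2 * (D + 1)) ≤ n := Nat.div_mul_le_self _ _
  have hq1 : n < (q + 1) * (2 * (D + 1)) := by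
    have := Nat.lt_mul_div_succ n (show 0 < 2 * (D + 1) by omega)
    rw [mul_comm]; exact this
  have hq3 : 1 ≤ q := (Nat.one_le_div_iff (by omega)).2 (by omega)
  have key : q ^ D ≤
      ((Finset.Nat.antidiagonalTuple (D + 1) n).filter fun j => ∀ i, 2 ≤ j i).card := by
    have hsum : ∀ g : Fin D → ℕ, (∀ i, g i < q) → ∑ i, (2 + g i) + 2 ≤ n := fun g hg => by
      have h1 : ∑ i, (2 + g i) ≤ ∑ _i : Fin D, (1 + q) :=
        Finset.sum_le_sum fun i _ => by have := hg i; omega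
      simp only [Finset.sum_const, Finset.card_univ, Fintype.card_fin, smul_eq_mul] at h1
      nlinarith
    calc q ^ D = (Fintype.piFinset fun _ : Fin D => Finset.range q).card := by simp
      _ ≤ _ := by
        refine Finset.card_le_card_of_injOn (fun g : Fin D → ℕ =>
          (Fin.snoc (α := fun _ => ℕ) (fun i => 2 + g i) (n - ∑ i, (2 + g i)) : Fin (D + 1) → ℕ))
          (fun g hg => ?_) ?_
        · have hg' : ∀ i, g i < q := fun i =>
            Finset.mem_range.1 (Fintype.mem_piFinset.1 (Finset.mem_coe.1 hg) i)
          have := hsum g hg'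
          refine Finset.mem_filter.2 ⟨Finset.Nat.mem_antidiagonalTuple.2 ?_, fun i => ?_⟩
          · rw [Fin.sum_univ_castSucc]
            simp only [Fin.snoc_castSucc, Fin.snoc_last]
            omega
          · refine Fin.lastCases ?_ (fun i => ?_) i
            · simp only [Fin.snoc_last]; omega
            · simp only [Fin.snoc_castSucc]; omega
        · intro a _ b _ h
          funext i
          have := congrFun h i.castSucc
          simpa using this
  calc n ^ D ≤ (4 * (D + 1) * q) ^ D := Nat.pow_le_pow_left (by nlinarith) D
    _ = (4 * (D + 1)) ^ D * q ^ D := by rw [mul_pow]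
    _ ≤ _ := Nat.mul_le_mul_left _ key

theorem rpow_sum_le_sum_rpow {ι : Type*} (s : Finset ι) (a : ι → ℝ≥0∞) {q : ℝ} (hq : 0 < q)
    (hq1 : q ≤ 1) : (∑ i ∈ s, a i) ^ q ≤ ∑ i ∈ s, a i ^ q := by
  classical
  induction s using Finset.induction_on with
  | empty => simp [hq]
  | insert i s hi ih =>
    rw [Finset.sum_insert hi, Finset.sum_insert hi]
    exact (ENNReal.rpow_add_le_add_rpow _ _ hq.le hq1).trans (add_le_add_right ih _)

theorem lintegral_pi_prod {Ω : Type*} [MeasurableSpace Ω] {μ : Measure Ω} [SigmaFinite μ] :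
    ∀ {d : ℕ} {g : Fin d → Ω → ℝ≥0∞}, (∀ i, Measurable (g i)) →
      ∫⁻ x, ∏ i, g i (x i) ∂(Measure.pi fun _ => μ) = ∏ i, ∫⁻ y, g i y ∂μ
  | 0, g, hg => by simp
  | d + 1, g, hg => by
    have hm : Measurable fun x : Fin (d + 1) → Ω => ∏ i, g i (x i) :=
      Finset.measurable_fun_prod _ fun i _ => (hg i).comp (measurable_pi_apply i)
    have hm' : Measurable fun x : Fin d → Ω => ∏ i, g (Fin.succ i) (x i) :=
      Finset.measurable_fun_prod _ fun i _ => (hg _).comp (measurable_pi_apply i)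
    rw [lintegral_fin_succ_pi hm, Fin.prod_univ_succ]
    simp_rw [Fin.prod_univ_succ, Fin.cons_zero, Fin.cons_succ]
    simp_rw [lintegral_const_mul _ hm']
    rw [lintegral_mul_const _ (hg 0), lintegral_pi_prod fun i => hg (Fin.succ i)]

/-- The indices of total order `n` of the dyadic blocks carrying the extremal polynomial. -/
def fatLevels (d n : ℕ) : Finset (Fin d → ℕ) :=
  (Finset.Nat.antidiagonalTuple d n).filter fun j => ∀ i, 2 ≤ j i

/-- The coefficients of a tensor product of modulated Fejér kernels. -/
def tensorCoeff {d : ℕ} (k : Fin d → ℤ) : ℝ := ∏ i, bumpCoeff (lev (k i) - 2) (k i)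

/-- The frequencies of the extremal polynomial. -/
def fatFreqs (d n : ℕ) : Finset (Fin d → ℤ) :=
  (fatLevels d n).biUnion fun j => Fintype.piFinset fun i => blockF (j i)

theorem mem_fatFreqs {d n : ℕ} {k : Fin d → ℤ} :
    k ∈ fatFreqs d n ↔ (fun i => lev (k i)) ∈ fatLevels d n := by
  simp only [fatFreqs, Finset.mem_biUnion, Fintype.mem_piFinset, mem_blockF]
  constructor
  · rintro ⟨j, hj, hk⟩
    rwa [show (fun i => lev (k i)) = j from funext hk]
  · exact fun h => ⟨_, h, fun _ => rfl⟩

/-- The extremal polynomial for the lower bound. -/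
def fatPoly (d n : ℕ) (t : ℝ) (x : Fin d → ℝ) : ℂ :=
  ∑ k ∈ fatFreqs d n, ((t * tensorCoeff k : ℝ) : ℂ) * expk d k x

theorem fCoeff_fatPoly (d n : ℕ) (t : ℝ) (k : Fin d → ℤ) :
    fCoeff d (fatPoly d n t) k = if k ∈ fatFreqs d n then ((t * tensorCoeff k : ℝ) : ℂ) else 0 :=
  fCoeff_trigPoly d (fatFreqs d n) _ k

theorem blockProj_fatPoly (d n : ℕ) (t : ℝ) (j : Fin d → ℕ) (x : Fin d → ℝ) :
    blockProj d (fatPoly d n t) j x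
      = if j ∈ fatLevels d n then (t : ℂ) * ∏ i, bump (j i - 2) (x i) else 0 := by
  have hlev : ∀ k ∈ Fintype.piFinset fun i => blockF (j i), (fun i => lev (k i)) = j :=
    fun k hk => funext fun i => mem_blockF.1 (Fintype.mem_piFinset.1 hk i)
  simp only [blockProj, fCoeff_fatPoly, mem_fatFreqs]
  split_ifs with h
  · have hj : ∀ i, j i - 2 + 2 = j i := fun i => by
      have := (Finset.mem_filter.1 h).2 i
      omega
    simp only [bump, hj]
    rw [Finset.prod_univ_sum, Finset.mul_sum]
    refine Finset.sum_congr rfl fun k hk => ?_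
    rw [hlev k hk, if_pos h, expk_eq_prod, Finset.prod_mul_distrib, tensorCoeff]
    push_cast
    have : ∀ i, lev (k i) = j i := fun i => congrFun (hlev k hk) i
    simp_rw [this]
    ring
  · refine Finset.sum_eq_zero fun k hk => ?_
    rw [hlev k hk, if_neg h, zero_mul]

theorem card_fatLevels_le (D n : ℕ) : (fatLevels (D + 1) n).card ≤ (n + 1) ^ D :=
  (Finset.card_filter_le _ _).trans (card_antidiagonalTuple_succ_le D n)

theorem lintegral_squareFun_fatPoly_le (D n : ℕ) {s t P : ℝ} (ht : 0 ≤ t) (hP1 : 1 < P)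
    (hP2 : P ≤ 2) :
    ∫⁻ x in cube (D + 1), squareFun (D + 1) s (fatPoly (D + 1) n t) x ^ P ≤
      ENNReal.ofReal ((2 ^ (n * s) * t) ^ P * ((n + 1) ^ D * ((2 : ℝ) ^ n) ^ (P - 1))) := by
  have hP0 : 0 < P := by linarith
  set J := fatLevels (D + 1) n with hJ
  have hpt : ∀ x, squareFun (D + 1) s (fatPoly (D + 1) n t) x ^ P ≤
      ∑ j ∈ J, ENNReal.ofReal ((2 ^ (n * s) * t) ^ P) * ∏ i, ‖bump (j i - 2) (x i)‖ₑ ^ P := by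
    intro x
    rw [squareFun, tsum_eq_sum (s := J) fun j hj => by
      rw [blockProj_fatPoly, if_neg hj]; simp, ← ENNReal.rpow_mul]
    refine (rpow_sum_le_sum_rpow _ _ (by linarith) (by linarith)).trans (le_of_eq ?_)
    refine Finset.sum_congr rfl fun j hj => ?_
    rw [blockProj_fatPoly, if_pos hj, ← ENNReal.rpow_natCast, ← ENNReal.rpow_mul,
      show ((2 : ℕ) : ℝ) * (1 / 2 * P) = P by push_cast; ring,
      Finset.Nat.mem_antidiagonalTuple.1 (Finset.mem_filter.1 hj).1, ← enorm_eq_nnnorm, enorm_mul,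
      ← ofReal_norm (t : ℂ), Complex.norm_real, Real.norm_of_nonneg ht, ← mul_assoc,
      ← ENNReal.ofReal_mul (by positivity), ENNReal.mul_rpow_of_nonneg _ _ hP0.le,
      ENNReal.ofReal_rpow_of_nonneg (by positivity) hP0.le]
    congr 1
    rw [ENNReal.prod_rpow_of_nonneg hP0.le]
    congr 1
    simp only [← ofReal_norm, norm_prod]
    rw [ENNReal.ofReal_prod_of_nonneg fun i _ => norm_nonneg _]
  have hmeas : ∀ m : ℕ, Measurable fun y => ‖bump m y‖ₑ ^ P := fun m =>
    (continuous_bump m).measurable.enorm.pow_const P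
  have hmeas' : ∀ j : Fin (D + 1) → ℕ, Measurable fun x : Fin (D + 1) → ℝ =>
      ∏ i, ‖bump (j i - 2) (x i)‖ₑ ^ P := fun j =>
    Finset.measurable_fun_prod _ fun i _ => (hmeas _).comp (measurable_pi_apply i)
  have hint : ∀ j ∈ J, ∫⁻ x in cube (D + 1), ∏ i, ‖bump (j i - 2) (x i)‖ₑ ^ P
      ≤ ENNReal.ofReal (((2 : ℝ) ^ n) ^ (P - 1)) := by
    intro j hj
    rw [restrict_cube, lintegral_pi_prod fun i => hmeas (j i - 2)]
    calc _ ≤ ∏ i, ENNReal.ofReal (((2 : ℝ) ^ j i) ^ (P - 1)) := by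
          refine Finset.prod_le_prod' fun i _ => (lintegral_bump_le _ hP1.le).trans ?_
          refine ENNReal.ofReal_le_ofReal (Real.rpow_le_rpow (by positivity) ?_ (by linarith))
          exact pow_le_pow_right₀ one_le_two (Nat.sub_le _ _)
      _ = _ := by
          rw [← ENNReal.ofReal_prod_of_nonneg fun i _ => by positivity,
            Real.finsetProd_rpow _ _ fun i _ => by positivity, Finset.prod_pow_eq_pow_sum,
            Finset.Nat.mem_antidiagonalTuple.1 (Finset.mem_filter.1 hj).1]
  calc _ ≤ ∫⁻ x in cube (D + 1), ∑ j ∈ J, ENNReal.ofReal ((2 ^ (n * s) * t) ^ P) *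
          ∏ i, ‖bump (j i - 2) (x i)‖ₑ ^ P := lintegral_mono hpt
    _ = ∑ j ∈ J, ENNReal.ofReal ((2 ^ (n * s) * t) ^ P) *
          ∫⁻ x in cube (D + 1), ∏ i, ‖bump (j i - 2) (x i)‖ₑ ^ P := by
        rw [lintegral_finsetSum _ fun j _ => (hmeas' j).const_mul _]
        exact Finset.sum_congr rfl fun j _ => lintegral_const_mul _ (hmeas' j)
    _ ≤ ∑ _j ∈ J, ENNReal.ofReal ((2 ^ (n * s) * t) ^ P) *
          ENNReal.ofReal (((2 : ℝ) ^ n) ^ (P - 1)) := by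
        gcongr with j hj
        exact hint j hj
    _ = (J.card : ℝ≥0∞) * ENNReal.ofReal ((2 ^ (n * s) * t) ^ P * ((2 : ℝ) ^ n) ^ (P - 1)) := by
        rw [Finset.sum_const, nsmul_eq_mul, ← ENNReal.ofReal_mul (by positivity)]
    _ ≤ ENNReal.ofReal ((n + 1) ^ D) *
          ENNReal.ofReal ((2 ^ (n * s) * t) ^ P * ((2 : ℝ) ^ n) ^ (P - 1)) := by
        gcongr
        rw [← ENNReal.ofReal_natCast]
        refine ENNReal.ofReal_le_ofReal ?_
        exact_mod_cast card_fatLevels_le D n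
    _ = _ := by
        rw [← ENNReal.ofReal_mul (by positivity)]
        congr 1
        ring

/-- The frequencies at which the coefficients of the extremal polynomial are large. -/
def largeFreqs (d n : ℕ) : Finset (Fin d → ℤ) :=
  (fatLevels d n).biUnion fun j => Fintype.piFinset fun i =>
    (blockF (j i)).filter fun k => 1 / 2 ≤ bumpCoeff (j i - 2) k

theorem of_mem_largeFreqs {d n : ℕ} {k : Fin d → ℤ} (hk : k ∈ largeFreqs d n) :
    k ∈ fatFreqs d n ∧ (1 / 2 : ℝ) ^ d ≤ tensorCoeff k := by
  simp only [largeFreqs, Finset.mem_biUnion, Fintype.mem_piFinset, Finset.mem_filter,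
    mem_blockF] at hk
  obtain ⟨j, hj, hk⟩ := hk
  have hlev : (fun i => lev (k i)) = j := funext fun i => (hk i).1
  refine ⟨mem_fatFreqs.2 (hlev ▸ hj), ?_⟩
  calc (1 / 2 : ℝ) ^ d = ∏ _i : Fin d, (1 / 2 : ℝ) := by simp
    _ ≤ _ := by
      refine Finset.prod_le_prod (fun _ _ => by norm_num) fun i _ => ?_
      rw [(hk i).1]
      exact (hk i).2

theorem le_card_largeFreqs (D n : ℕ) (hn : 4 * (D + 1) ≤ n) :
    2 ^ n * n ^ D ≤ 8 ^ (D + 1) * (4 * (D + 1)) ^ D * (largeFreqs (D + 1) n).card := by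
  have hcard : 2 ^ n * (fatLevels (D + 1) n).card ≤ 8 ^ (D + 1) * (largeFreqs (D + 1) n).card := by
    rw [largeFreqs, Finset.card_biUnion, Finset.mul_sum, mul_comm, ← smul_eq_mul,
      ← Finset.sum_const]
    · refine Finset.sum_le_sum fun j hj => ?_
      obtain ⟨hj1, hj2⟩ := Finset.mem_filter.1 hj
      rw [Fintype.card_piFinset, ← Finset.Nat.mem_antidiagonalTuple.1 hj1,
        ← Finset.prod_pow_eq_pow_sum]
      calc _ ≤ ∏ i, 8 * ((blockF (j i)).filter fun k => 1 / 2 ≤ bumpCoeff (j i - 2) k).card := by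
            refine Finset.prod_le_prod' fun i _ => ?_
            have h := le_card_bumpCoeff (j i - 2)
            have e : j i - 2 + 2 = j i := Nat.sub_add_cancel (hj2 i)
            rw [e] at h
            have e2 : 2 ^ j i = 4 * 2 ^ (j i - 2) := by
              conv_lhs => rw [← e]
              ring
            omega
        _ = _ := by rw [Finset.prod_mul_distrib]; simp
    · intro a _ b _ hab
      refine Finset.disjoint_left.2 fun k hka hkb => hab (funext fun i => ?_)
      have h1 := (Finset.mem_filter.1 (Fintype.mem_piFinset.1 hka i)).1
      have h2 := (Finset.mem_filter.1 (Fintype.mem_piFinset.1 hkb i)).1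
      rw [← mem_blockF.1 h1, mem_blockF.1 h2]
  calc 2 ^ n * n ^ D ≤ 2 ^ n * ((4 * (D + 1)) ^ D * (fatLevels (D + 1) n).card) :=
        Nat.mul_le_mul_left _ (le_card_antidiagonalTuple D n hn)
    _ = (4 * (D + 1)) ^ D * (2 ^ n * (fatLevels (D + 1) n).card) := by ring
    _ ≤ (4 * (D + 1)) ^ D * (8 ^ (D + 1) * (largeFreqs (D + 1) n).card) :=
        Nat.mul_le_mul_left _ hcard
    _ = _ := by ring

theorem le_wienerNorm_fatPoly_sub {d n m : ℕ} {η : ℝ≥0∞} (hη0 : 0 < η) (hη : η ≠ ∞) {t : ℝ}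
    (ht : 0 ≤ t) (hm : 2 * m ≤ (largeFreqs d n).card) {g : (Fin d → ℝ) → ℂ}
    (hg : g ∈ trigPoly d m) :
    ENNReal.ofReal (t * (1 / 2) ^ d * (m : ℝ) ^ (1 / η.toReal))
      ≤ wienerNorm d 0 η (fatPoly d n t - g) := by
  classical
  obtain ⟨Λ, a, hΛ, rfl⟩ := hg
  have hE0 : 0 < η.toReal := ENNReal.toReal_pos hη0.ne' hη
  rw [wienerNorm_zero_eq hη]
  have hcoef : ∀ k ∈ largeFreqs d n \ Λ, ENNReal.ofReal (t * (1 / 2) ^ d) ≤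
      ‖fCoeff d (fatPoly d n t - fun x => ∑ k ∈ Λ, a k * expk d k x) k‖ₑ := by
    intro k hk
    obtain ⟨hk1, hk2⟩ := Finset.mem_sdiff.1 hk
    obtain ⟨hk3, hk4⟩ := of_mem_largeFreqs hk1
    have hi : IntegrableOn (fatPoly d n t) (cube d) := integrableOn_trigPoly d (fatFreqs d n) _
    rw [fCoeff_sub hi (integrableOn_trigPoly _ _ _), fCoeff_trigPoly, if_neg hk2,
      sub_zero, fCoeff_fatPoly, if_pos hk3, ← ofReal_norm, Complex.norm_real]
    refine ENNReal.ofReal_le_ofReal (le_trans ?_ (le_abs_self _))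
    gcongr
  have hcard : m ≤ (largeFreqs d n \ Λ).card := by
    have := Finset.le_card_sdiff Λ (largeFreqs d n)
    omega
  calc _ = ((m : ℝ≥0∞) * ENNReal.ofReal (t * (1 / 2) ^ d) ^ η.toReal) ^ (1 / η.toReal) := by
        rw [ENNReal.mul_rpow_of_nonneg _ _ (by positivity), ← ENNReal.rpow_mul,
          mul_one_div_cancel hE0.ne', ENNReal.rpow_one, mul_comm, ENNReal.ofReal_mul (by positivity),
          ← ENNReal.ofReal_rpow_of_nonneg (by positivity) (by positivity),
          ENNReal.ofReal_natCast, mul_comm]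
    _ ≤ (((largeFreqs d n \ Λ).card : ℝ≥0∞) *
          ENNReal.ofReal (t * (1 / 2) ^ d) ^ η.toReal) ^ (1 / η.toReal) := by gcongr
    _ = (∑ _k ∈ largeFreqs d n \ Λ,
          ENNReal.ofReal (t * (1 / 2) ^ d) ^ η.toReal) ^ (1 / η.toReal) := by
        rw [Finset.sum_const, nsmul_eq_mul]
    _ ≤ _ := by
        refine ENNReal.rpow_le_rpow (le_trans (Finset.sum_le_sum fun k hk => ?_)
          (ENNReal.sum_le_tsum (largeFreqs d n \ Λ))) (by positivity)
        exact ENNReal.rpow_le_rpow (hcoef k hk) hE0.le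

theorem le_sigmaClass (D : ℕ) {p η : ℝ≥0∞} {r : ℝ} (hP1 : 1 < p.toReal) (hP2 : p.toReal ≤ 2)
    (hη0 : 0 < η) (hη : η ≠ ∞) (hr0 : r ≠ 0) {m n : ℕ}
    (hm : 2 * m ≤ (largeFreqs (D + 1) n).card) :
    ENNReal.ofReal ((1 / 2) ^ (D + 1) * (m : ℝ) ^ (1 / η.toReal) *
      ((2 : ℝ) ^ (-(n * (r + 1 - 1 / p.toReal))) * ((n : ℝ) + 1) ^ (-(D / p.toReal))))
      ≤ sigmaClass (D + 1) m (sobolevNorm (D + 1) r p) (wienerNorm (D + 1) 0 η) := by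
  have hP0 : 0 < p.toReal := by linarith
  set P := p.toReal with hP
  set t : ℝ := (2 : ℝ) ^ (-(n * (r + 1 - 1 / P))) * ((n : ℝ) + 1) ^ (-(D / P)) with ht
  have ht0 : 0 ≤ t := by positivity
  have hball : fatPoly (D + 1) n t ∈ unitBall (D + 1) (sobolevNorm (D + 1) r p) := by
    refine ⟨integrableOn_trigPoly (D + 1) (fatFreqs (D + 1) n) _, ?_⟩
    rw [sobolevNorm_eq hr0]
    refine (ENNReal.rpow_le_rpow (lintegral_squareFun_fatPoly_le D n ht0 hP1 hP2)
      (by positivity)).trans (le_of_eq ?_)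
    rw [ENNReal.ofReal_rpow_of_nonneg (by positivity) (by positivity), ENNReal.ofReal_eq_one,
      Real.mul_rpow (by positivity) (by positivity), ← Real.rpow_mul (by positivity),
      mul_one_div_cancel hP0.ne', Real.rpow_one, Real.mul_rpow (by positivity) (by positivity),
      ← Real.rpow_natCast ((n : ℝ) + 1), ← Real.rpow_natCast (2 : ℝ), ← Real.rpow_mul (by positivity),
      ← Real.rpow_mul zero_le_two, ← Real.rpow_mul zero_le_two, ht]
    have e1 : (2 : ℝ) ^ (n * r) * (2 : ℝ) ^ (-(n * (r + 1 - 1 / P))) *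
        (2 : ℝ) ^ (n * (P - 1) * (1 / P)) = 1 := by
      rw [← Real.rpow_add two_pos, ← Real.rpow_add two_pos, show n * r + -(n * (r + 1 - 1 / P)) +
        n * (P - 1) * (1 / P) = 0 by field_simp; ring, Real.rpow_zero]
    have e2 : ((n : ℝ) + 1) ^ (-(D / P)) * ((n : ℝ) + 1) ^ (D * (1 / P)) = 1 := by
      rw [← Real.rpow_add (by positivity), show -(D / P) + D * (1 / P) = 0 by ring, Real.rpow_zero]
    calc _ = ((2 : ℝ) ^ (n * r) * (2 : ℝ) ^ (-(n * (r + 1 - 1 / P))) *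
          (2 : ℝ) ^ (n * (P - 1) * (1 / P))) *
          (((n : ℝ) + 1) ^ (-(D / P)) * ((n : ℝ) + 1) ^ (D * (1 / P))) := by ring
      _ = 1 := by rw [e1, e2, one_mul]
  refine le_trans ?_ (le_iSup₂_of_le (fatPoly (D + 1) n t) hball le_rfl)
  refine le_iInf₂ fun g hg => ?_
  refine le_trans (le_of_eq ?_) (le_wienerNorm_fatPoly_sub hη0 hη ht0 hm hg)
  congr 1
  ring

/-- The lower bound for the `m`-term widths. -/
theorem exists_le_sigmaClass (D : ℕ) {p η : ℝ≥0∞} {r : ℝ} (hP1 : 1 < p.toReal)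
    (hP2 : p.toReal ≤ 2) (hη0 : 0 < η) (hη : η ≠ ∞) (hr0 : 0 < r) :
    ∃ c : ℝ, 0 < c ∧ ∃ m₀ : ℕ, ∀ m : ℕ, m₀ ≤ m →
      ENNReal.ofReal (c * ((m : ℝ) ^ (-(r + 1 - 1 / p.toReal - 1 / η.toReal)) *
          logStar m ^ (D * (r + 1 - 2 / p.toReal))))
        ≤ sigmaClass (D + 1) m (sobolevNorm (D + 1) r p) (wienerNorm (D + 1) 0 η) := by
  set P := p.toReal with hP
  set γ := r + 1 - 1 / P with hγ
  have hP0 : 0 < P := by linarith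
  have hγ0 : 0 < γ := by
    have : 1 / P < 1 := (div_lt_one hP0).2 hP1
    linarith
  set K : ℝ := 8 ^ (D + 1) * (4 * (D + 1)) ^ D with hK
  have hK0 : 0 < K := by positivity
  set A : ℝ := 4 * 2 ^ D * K with hA
  have hA0 : 0 < A := by positivity
  obtain ⟨m₀, hm₀⟩ := exists_dyadic_scale D hA0
  refine ⟨(1 / 2) ^ (D + 1) * (A ^ (-γ) * 3 ^ (-(D / P))), by positivity,
    max m₀ (2 ^ (8 * (D + 1))), fun m hm => ?_⟩
  obtain ⟨hm1, n, hn1, hn2, hn3, hn4⟩ := hm₀ m (le_of_max_le_left hm)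
  have hL1 := one_le_logStar m
  have hLbig : ((8 * (D + 1) : ℕ) : ℝ) ≤ logStar m := by
    refine le_trans ?_ (le_max_left _ _)
    rw [Real.le_logb_iff_rpow_le one_lt_two (by exact_mod_cast hm1), Real.rpow_natCast]
    exact_mod_cast le_of_max_le_right hm
  set L := logStar m with hL
  have hm0 : (0 : ℝ) < m := by exact_mod_cast hm1
  have hn5 : (n : ℝ) + 1 ≤ 3 * L := by linarith
  have hn6 : 4 * (D + 1) ≤ n := by
    have : ((8 * (D + 1) : ℕ) : ℝ) ≤ ((2 * n : ℕ) : ℝ) := by push_cast at hLbig ⊢; linarith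
    have := Nat.cast_le.1 this
    omega
  have hcard : 2 * m ≤ (largeFreqs (D + 1) n).card := by
    have h1 : ((2 ^ n * n ^ D : ℕ) : ℝ) ≤ K * (largeFreqs (D + 1) n).card := by
      have := le_card_largeFreqs D n hn6
      rw [hK]
      exact_mod_cast this
    have h2 : K * (2 * m) ≤ 2 ^ n * (n : ℝ) ^ D := by
      calc K * (2 * m) = (A * m / L ^ D / 2) * (L / 2) ^ D := by
            rw [hA, div_pow]; field_simp; ring
        _ ≤ 2 ^ n * (n : ℝ) ^ D := by
            gcongr
            · linarith
            · linarith
    push_cast at h1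
    have h3 : ((2 * m : ℕ) : ℝ) ≤ ((largeFreqs (D + 1) n).card : ℝ) := by
      push_cast
      exact le_of_mul_le_mul_left (h2.trans h1) hK0
    exact_mod_cast h3
  refine le_trans (ENNReal.ofReal_le_ofReal ?_) (le_sigmaClass D hP1 hP2 hη0 hη hr0.ne' hcard)
  clear_value A
  have h1 : A ^ (-γ) * ((m : ℝ) ^ (-γ) * L ^ (D * γ)) ≤ (2 : ℝ) ^ (-(n * γ)) := by
    calc _ = (A * (m * (L ^ D)⁻¹)) ^ (-γ) := by
          rw [Real.mul_rpow (by positivity) (by positivity),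
            Real.mul_rpow (by positivity) (by positivity), Real.inv_rpow (by positivity),
            ← Real.rpow_neg (by positivity), neg_neg, ← Real.rpow_natCast L,
            ← Real.rpow_mul (by positivity)]
      _ ≤ ((2 : ℝ) ^ n) ^ (-γ) := by
          refine Real.rpow_le_rpow_of_nonpos (by positivity) ?_ (by linarith)
          rw [← mul_assoc, ← div_eq_mul_inv]
          exact hn3
      _ = _ := by
          rw [← Real.rpow_natCast, ← Real.rpow_mul zero_le_two]; congr 1; ring
  have h2 : 3 ^ (-(D / P)) * L ^ (-(D / P)) ≤ ((n : ℝ) + 1) ^ (-(D / P)) := by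
    rw [← Real.mul_rpow (by norm_num) (by positivity)]
    refine Real.rpow_le_rpow_of_nonpos (by positivity) hn5 ?_
    have : 0 ≤ D / P := by positivity
    linarith
  have e1 : L ^ (D * (r + 1 - 2 / P)) = L ^ (D * γ) * L ^ (-(D / P)) := by
    rw [← Real.rpow_add (by positivity)]
    congr 1
    rw [hγ]
    ring
  have e2 : (m : ℝ) ^ (-(γ - 1 / η.toReal)) = (m : ℝ) ^ (1 / η.toReal) * (m : ℝ) ^ (-γ) := by
    rw [← Real.rpow_add hm0]
    congr 1
    ring
  calc _ = (1 / 2) ^ (D + 1) * (m : ℝ) ^ (1 / η.toReal) *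
        ((A ^ (-γ) * ((m : ℝ) ^ (-γ) * L ^ (D * γ))) * (3 ^ (-(D / P)) * L ^ (-(D / P)))) := by
        rw [e1, e2]; ring
    _ ≤ _ := by gcongr

/-- `σ_m(S^r_p W)_{A_η}` for `1 < p ≤ 2`, `0 < η ≤ p`
and `r > 1/p + 1/η - 1`. -/
theorem statement18 (d : ℕ) (hd : 1 ≤ d) (p η : ℝ≥0∞) (hp1 : 1 < p) (hp2 : p ≤ 2)
    (hη : 0 < η) (hηp : η ≤ p) (r : ℝ) (hr : 1/p.toReal + 1/η.toReal - 1 < r) :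
    IsAsympEquiv (fun m => sigmaClass d m (sobolevNorm d r p) (wienerNorm d 0 η))
      (fun m => (m : ℝ) ^ (-(r + 1 - 1/p.toReal - 1/η.toReal)) *
        logStar m ^ (((d : ℝ) - 1) * (r + 1 - 2/p.toReal))) := by
  obtain ⟨D, rfl⟩ : ∃ D, d = D + 1 := ⟨d - 1, by omega⟩
  have hpt : p ≠ ∞ := (hp2.trans_lt (by simp)).ne
  have hηt : η ≠ ∞ := (hηp.trans_lt hpt.lt_top).ne
  have hP1 : 1 < p.toReal := by
    simpa using (ENNReal.toReal_lt_toReal (by simp) hpt).2 hp1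
  have hP2 : p.toReal ≤ 2 := by
    simpa using (ENNReal.toReal_le_toReal hpt (by simp)).2 hp2
  have hE0 : 0 < η.toReal := ENNReal.toReal_pos hη.ne' hηt
  have hEP : η.toReal ≤ p.toReal := (ENNReal.toReal_le_toReal hηt hpt).2 hηp
  have hηP : 1 / p.toReal ≤ 1 / η.toReal := one_div_le_one_div_of_le hE0 hEP
  have hr0 : 0 < r := by
    have : 1 / 2 ≤ 1 / p.toReal := one_div_le_one_div_of_le (by linarith) hP2
    linarith
  obtain ⟨C, hC, m₁, h₁⟩ := exists_sigmaClass_upper D hp1 hp2 hη hηp hr hr0.ne' hηP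
  obtain ⟨c, hc, m₂, h₂⟩ := exists_le_sigmaClass D hP1 hP2 hη hηt hr0
  have hD : (((D + 1 : ℕ) : ℝ) - 1) = D := by push_cast; ring
  refine ⟨c, C, hc, hC, max m₁ m₂, fun m hm => ?_⟩
  simp only [hD]
  exact ⟨h₂ m (le_of_max_le_right hm), h₁ m (le_of_max_le_left hm)⟩

end Paper
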